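/- Fix a real number a > 0. There exist constants C > 0 and N (depending only on a) such that for all n ≥ N and all integers ℓ with n − ℓ even and (ℓ − A(n))/√(B(n)) ∈ [−a, a], the probability (with σ, τ independent uniform on S_n) satisfies | √(2π B(n)) · exp((ℓ − A(n))²/(2 B(n))) · Pr[C([σ,τ]) = ℓ] − 2 | ≤ C/√(log n), where A(n) = Σ_{i=1}^n 1/i and B(n) = Σ_{i=1}^n (1/i − 1/i²). Equivalently, the random variable G_n = n/2 − C([σ,τ])/2 + 1 satisfies the same local central limit theorem, since G_n = n/2 − ℓ/2 + 1 exactly when C([σ,τ]) = ℓ. -/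

import Mathlib

/-- Number of cycles of a permutation of `Fin n`, counting fixed points as 1-cycles:
the cycles of length at least 2 are counted by `cycleType`, and fixed points are
counted separately. -/
def numCycles {n : ℕ} (π : Equiv.Perm (Fin n)) : ℕ :=
  Multiset.card π.cycleType + (Finset.univ.filter fun i => π i = i).card

/-- `A n = ∑_{i=1}^n 1/i`. -/
noncomputable def A (n : ℕ) : ℝ := ∑ i ∈ Finset.Icc 1 n, (1 : ℝ) / i

/-- `B n = ∑_{i=1}^n (1/i - 1/i²)`. -/
noncomputable def B (n : ℕ) : ℝ := ∑ i ∈ Finset.Icc 1 n, ((1 : ℝ) / i - 1 / (i : ℝ) ^ 2)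

/-- The probability, for `σ, τ` independent uniform on `S_n`, that the commutator
`[σ,τ] = στσ⁻¹τ⁻¹` has exactly `ℓ` cycles. -/
noncomputable def cycProb (n ℓ : ℕ) : ℝ :=
  (Nat.card {p : Equiv.Perm (Fin n) × Equiv.Perm (Fin n) //
      numCycles (p.1 * p.2 * p.1⁻¹ * p.2⁻¹) = ℓ} : ℝ) / (n.factorial : ℝ) ^ 2

open Equiv

abbrev GA (α : Type) := MonoidAlgebra ℚ (Perm α)

section part1
variable {α β : Type} [Fintype α] [DecidableEq α] [Fintype β] [DecidableEq β]

def fixCnt (N : ℕ) (g : Perm α) : ℕ :=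
  Fintype.card {f : α → Fin N // ∀ i, f (g i) = f i}

noncomputable def rowSum (r : α → ℕ) : GA α :=
  ∑ g : Perm α, if (∀ i, r (g i) = r i) then MonoidAlgebra.of ℚ (Perm α) g else 0

noncomputable def colSum (c : α → ℕ) : GA α :=
  ∑ g : Perm α, if (∀ i, c (g i) = c i) then
    ((Perm.sign g : ℤ) : ℚ) • MonoidAlgebra.of ℚ (Perm α) g else 0

noncomputable def cycSum (α : Type) [Fintype α] [DecidableEq α] (N : ℕ) : GA α :=
  ∑ g : Perm α, (fixCnt N g : ℚ) • MonoidAlgebra.of ℚ (Perm α) g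

def optHom (α : Type) : Perm α →* Perm (Option α) where
  toFun g := optionCongr g
  map_one' := by ext1 x; cases x <;> rfl
  map_mul' g h := by ext1 x; cases x <;> rfl

noncomputable def iotaO (α : Type) : GA α →ₐ[ℚ] GA (Option α) :=
  MonoidAlgebra.mapDomainAlgHom ℚ ℚ (optHom α)

lemma iotaO_of (g : Perm α) : iotaO α (MonoidAlgebra.of ℚ _ g) = MonoidAlgebra.of ℚ _ (optHom α g) := by
  simp [iotaO, MonoidAlgebra.of]

lemma sum_perm_option {M : Type*} [AddCommMonoid M] (F : Perm (Option α) → M) :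
    ∑ g, F g = ∑ k : Option α, ∑ g : Perm α, F (swap none k * optHom α g) := by
  rw [← Equiv.sum_comp Perm.decomposeOption.symm, Fintype.sum_prod_type]
  rfl

lemma fixCnt_none (N : ℕ) (g : Perm α) : fixCnt N (optHom α g) = N * fixCnt N g := by
  unfold fixCnt
  rw [← Fintype.card_fin N, ← Fintype.card_prod, Fintype.card_fin N]
  refine Fintype.card_congr ⟨fun f => (f.1 none, ⟨fun i => f.1 (some i), fun i => f.2 (some i)⟩),
    fun p => ⟨fun o => o.elim p.1 p.2.1, ?_⟩, ?_, ?_⟩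
  · intro i; cases i with
    | none => rfl
    | some i => exact p.2.2 i
  · intro f; ext i; cases i <;> rfl
  · intro p; rfl

lemma fixCnt_some (N : ℕ) (k : α) (g : Perm α) :
    fixCnt N (swap none (some k) * optHom α g) = fixCnt N g := by
  have e1 : ∀ i : α, (swap none (some k) * optHom α g) (some i) = if g i = k then none else some (g i) := by
    intro i
    show swap none (some k) (some (g i)) = _
    split_ifs with h
    · rw [h, swap_apply_right]
    · rw [swap_apply_of_ne_of_ne] <;> simp [h]
  have e2 : (swap none (some k) * optHom α g) none = some k := by
    show swap none (some k) none = _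
    simp
  unfold fixCnt
  refine Fintype.card_congr ⟨fun f => ⟨fun i => f.1 (some i), ?_⟩,
    fun f => ⟨fun o => o.elim (f.1 k) f.1, ?_⟩, ?_, ?_⟩
  · intro i
    have h := f.2 (some i)
    have h0 := f.2 none
    rw [e2] at h0
    rw [e1] at h
    split_ifs at h with hk
    · show f.1 (some (g i)) = f.1 (some i)
      rw [hk, h0, h]
    · exact h
  · intro i
    cases i with
    | none => rw [e2]; rfl
    | some i =>
      rw [e1]; split_ifs with hk
      · have := f.2 i; rw [hk] at this; exact this
      · exact f.2 i
  · intro f; ext i; cases i with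
    | none => have h0 := f.2 none; rw [e2] at h0; exact congrArg _ h0
    | some i => rfl
  · intro f; rfl

noncomputable def jm (α : Type) [Fintype α] [DecidableEq α] : GA (Option α) :=
  ∑ k : α, MonoidAlgebra.of ℚ _ (swap none (some k))

lemma cycSum_option (N : ℕ) : cycSum (Option α) N = ((N : ℚ) • 1 + jm α) * iotaO α (cycSum α N) := by
  unfold cycSum jm
  rw [sum_perm_option, Fintype.sum_option, add_mul, map_sum]
  congr 1
  · rw [smul_mul_assoc, one_mul, Finset.smul_sum]
    refine Finset.sum_congr rfl fun g _ => ?_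
    rw [swap_self, ← Perm.one_def, one_mul, fixCnt_none, map_smul, iotaO_of, smul_smul]
    push_cast; rfl
  · rw [Finset.sum_mul]
    refine Finset.sum_congr rfl fun k _ => ?_
    rw [Finset.mul_sum]
    refine Finset.sum_congr rfl fun g _ => ?_
    rw [fixCnt_some, map_smul, iotaO_of, mul_smul_comm, ← map_mul]

lemma stab_iff (r : Option α → ℕ) (k : Option α) (g : Perm α) :
    (∀ i, r ((swap none k * optHom α g) i) = r i) ↔
      (r k = r none ∧ ∀ i, r (some (g i)) = r (some i)) := by
  have e2 : (swap none k * optHom α g) none = k := by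
    show swap none k none = _
    simp
  have e3 : ∀ i, (swap none k * optHom α g) (some i) = swap none k (some (g i)) := fun i => rfl
  have e4 : r k = r none → ∀ j, r (swap none k j) = r j := by
    intro h j
    rcases eq_or_ne j none with rfl | h1
    · simp [h]
    · rcases eq_or_ne j k with rfl | h2
      · simp [h]
      · rw [swap_apply_of_ne_of_ne h1 h2]
  constructor
  · intro h
    have h0 : r k = r none := by rw [← h none, e2]
    refine ⟨h0, fun i => ?_⟩
    rw [← h (some i), e3, e4 h0]
  · rintro ⟨h0, h⟩ i
    cases i with
    | none => rw [e2, h0]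
    | some i => rw [e3, e4 h0, h]

lemma rowSum_option (r : Option α → ℕ) :
    ∃ ρ : GA (Option α), rowSum r = ρ * iotaO α (rowSum fun i => r (some i)) := by
  refine ⟨∑ k : Option α, if r k = r none then MonoidAlgebra.of ℚ _ (swap none k) else 0, ?_⟩
  unfold rowSum
  rw [sum_perm_option, Finset.sum_mul, map_sum]
  refine Finset.sum_congr rfl fun k _ => ?_
  rw [Finset.mul_sum]
  refine Finset.sum_congr rfl fun g _ => ?_
  simp only [stab_iff]
  by_cases h1 : r k = r none <;> by_cases h2 : ∀ i, r (some (g i)) = r (some i) <;>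
    simp [h1, h2, iotaO_of, -MonoidAlgebra.of_apply, ← map_mul]

lemma colSum_inv (c : α → ℕ) : colSum c = ∑ g : Perm α, if (∀ i, c (g i) = c i) then
    ((Perm.sign g : ℤ) : ℚ) • MonoidAlgebra.of ℚ (Perm α) g⁻¹ else 0 := by
  unfold colSum
  rw [← Equiv.sum_comp (Equiv.inv (Perm α))]
  refine Finset.sum_congr rfl fun g _ => ?_
  have : (∀ i, c ((Equiv.inv (Perm α)) g i) = c i) ↔ ∀ i, c (g i) = c i := by
    constructor
    · intro h i; have := h (g i); simp at this; exact this.symm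
    · intro h i; have := h (g⁻¹ i); simp at this; simp [this]
  rw [if_congr this rfl rfl]
  simp only [Equiv.inv_apply, Perm.sign_inv]

lemma colSum_option (c : Option α → ℕ) :
    ∃ κ : GA (Option α), colSum c = iotaO α (colSum fun i => c (some i)) * κ := by
  refine ⟨∑ k : Option α, if c k = c none then
    ((Perm.sign (swap none k) : ℤ) : ℚ) • MonoidAlgebra.of ℚ _ (swap none k) else 0, ?_⟩
  rw [colSum_inv, colSum_inv]
  rw [sum_perm_option, Finset.mul_sum, map_sum]
  refine Finset.sum_congr rfl fun k _ => ?_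
  rw [Finset.sum_mul]
  refine Finset.sum_congr rfl fun g _ => ?_
  simp only [stab_iff]
  have hs : Perm.sign (optHom α g) = Perm.sign g := Equiv.optionCongr_sign g
  by_cases h1 : c k = c none <;> by_cases h2 : ∀ i, c (some (g i)) = c (some i)
  · simp only [h1, h2, implies_true, and_self, if_true, map_smul, iotaO_of, smul_mul_smul_comm,
      ← map_mul, mul_inv_rev, swap_inv, Perm.sign_mul, hs]
    simp only [map_mul, map_inv, Units.val_mul, Int.cast_mul]
    rw [mul_comm ((Perm.sign (swap none k) : ℤ) : ℚ)]
  all_goals simp [h1, h2]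

lemma rowSum_mul_of (r : α → ℕ) (p : Perm α) (hp : ∀ i, r (p i) = r i) :
    rowSum r * MonoidAlgebra.of ℚ _ p = rowSum r := by
  unfold rowSum
  rw [Finset.sum_mul]
  rw [← Equiv.sum_comp (Equiv.mulRight p) (fun g : Perm α => if (∀ i, r (g i) = r i) then MonoidAlgebra.of ℚ (Perm α) g else 0)]
  refine Finset.sum_congr rfl fun g _ => ?_
  have : (∀ i, r ((Equiv.mulRight p) g i) = r i) ↔ ∀ i, r (g i) = r i := by
    simp only [coe_mulRight, Perm.coe_mul, Function.comp_apply]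
    constructor
    · intro h i; have := h (p⁻¹ i); have h2 := hp (p⁻¹ i); simp at this h2; rw [this, h2]
    · intro h i; rw [h, hp]
  simp only [this, ite_mul, zero_mul, ← map_mul]
  rfl

lemma of_mul_colSum (c : α → ℕ) (p : Perm α) (hp : ∀ i, c (p i) = c i) (hs : Perm.sign p = -1) :
    MonoidAlgebra.of ℚ _ p * colSum c = - colSum c := by
  unfold colSum
  rw [Finset.mul_sum]
  rw [← Equiv.sum_comp (Equiv.mulLeft p) (fun g : Perm α => if (∀ i, c (g i) = c i) then
    ((Perm.sign g : ℤ) : ℚ) • MonoidAlgebra.of ℚ (Perm α) g else 0), ← Finset.sum_neg_distrib]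
  refine Finset.sum_congr rfl fun g _ => ?_
  have : (∀ i, c ((Equiv.mulLeft p) g i) = c i) ↔ ∀ i, c (g i) = c i := by
    simp only [coe_mulLeft, Perm.coe_mul, Function.comp_apply, hp]
  rw [if_congr this rfl rfl]
  simp only [mul_ite, mul_zero, mul_smul_comm, ← map_mul, coe_mulLeft]
  split_ifs
  · rw [Perm.sign_mul, hs]; simp
  · simp

lemma swap_pres (r : α → ℕ) (i j : α) (h : r i = r j) : ∀ k, r (swap i j k) = r k := by
  intro k
  rcases eq_or_ne k i with rfl | h1
  · simp [h]
  · rcases eq_or_ne k j with rfl | h2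
    · simp [h]
    · rw [swap_apply_of_ne_of_ne h1 h2]

lemma jm_comm (y : GA α) : jm α * iotaO α y = iotaO α y * jm α := by
  induction y using MonoidAlgebra.induction_on with
  | of g =>
    rw [iotaO_of]
    unfold jm
    rw [Finset.sum_mul, Finset.mul_sum]
    rw [← Equiv.sum_comp g]
    refine Finset.sum_congr rfl fun k _ => ?_
    rw [← map_mul, ← map_mul]
    congr 1
    have := Equiv.mul_swap_eq_swap_mul (optHom α g) none (some k)
    exact this.symm
  | add a b ha hb => rw [map_add, mul_add, add_mul, ha, hb]
  | smul r f h => rw [map_smul, mul_smul_comm, smul_mul_assoc, h]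

lemma self_eq_neg_rat {y : GA α} (h : y = -y) : y = 0 := by
  have h2 : (2 : ℚ) • y = 0 := by rw [two_smul]; nth_rewrite 1 [h]; simp
  exact (smul_eq_zero.mp h2).resolve_left (by norm_num)

def GoodT (r c : α → ℕ) (N : ℕ) (w : ℚ) : Prop :=
  rowSum r * cycSum α N * colSum c = w • (rowSum r * colSum c)

lemma mid_jm (r c : Option α → ℕ) 
    (hinj : ∀ k, ¬ (r (some k) = r none ∧ c (some k) = c none))
    (hex : ∀ k, r (some k) ≠ r none → c (some k) ≠ c none →
      ∃ m, r (some m) = r (some k) ∧ c (some m) = c none) :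
    rowSum r * jm α * colSum c =
      (((Finset.univ.filter fun k : α => r (some k) = r none).card : ℚ) -
        ((Finset.univ.filter fun k : α => c (some k) = c none).card : ℚ)) •
        (rowSum r * colSum c) := by
  unfold jm
  rw [Finset.mul_sum, Finset.sum_mul, Finset.card_filter, Finset.card_filter]
  push_cast
  rw [← Finset.sum_sub_distrib, Finset.sum_smul]
  refine Finset.sum_congr rfl fun k _ => ?_
  by_cases h1 : r (some k) = r none
  · have h2 : c (some k) ≠ c none := fun h => hinj k ⟨h1, h⟩
    rw [rowSum_mul_of _ _ (swap_pres r _ _ h1.symm)]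
    simp [h1, h2]
  · by_cases h2 : c (some k) = c none
    · rw [mul_assoc, of_mul_colSum _ _ (swap_pres c _ _ h2.symm) (Perm.sign_swap (by simp))]
      simp [h1, h2]
    · obtain ⟨m, hm1, hm2⟩ := hex k h1 h2
      have hmk : m ≠ k := by rintro rfl; exact h2 hm2
      have key : rowSum r * MonoidAlgebra.of ℚ _ (swap none (some k)) * colSum c = 
          -(rowSum r * MonoidAlgebra.of ℚ _ (swap none (some k)) * colSum c) := by
        conv_lhs => rw [← rowSum_mul_of r (swap (some m) (some k)) (swap_pres r _ _ hm1)]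
        rw [mul_assoc (rowSum r), ← map_mul]
        have : swap (some m) (some k) * swap none (some k) = swap none (some k) * swap (some m) none := by
          have := Equiv.mul_swap_eq_swap_mul (swap none (some k)) (some m) none
          rw [this, swap_apply_left, swap_apply_of_ne_of_ne (by simp) (by simpa using hmk)]
        rw [this, map_mul, ← mul_assoc, mul_assoc _ _ (colSum c),
          of_mul_colSum _ _ (swap_pres c _ _ hm2) (Perm.sign_swap (by simp)), mul_neg]
      have : rowSum r * MonoidAlgebra.of ℚ _ (swap none (some k)) * colSum c = 0 := 
        self_eq_neg_rat key
      rw [this]; simp [h1, h2]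

lemma GoodT_option (r c : Option α → ℕ) (N : ℕ) (w : ℚ)
    (h : GoodT (fun i => r (some i)) (fun i => c (some i)) N w)
    (hinj : ∀ k, ¬ (r (some k) = r none ∧ c (some k) = c none))
    (hex : ∀ k, r (some k) ≠ r none → c (some k) ≠ c none →
      ∃ m, r (some m) = r (some k) ∧ c (some m) = c none) :
    GoodT r c N (w * (N + (((Finset.univ.filter fun k : α => r (some k) = r none).card : ℚ) -
        ((Finset.univ.filter fun k : α => c (some k) = c none).card : ℚ)))) := by
  unfold GoodT at *
  obtain ⟨ρ, hρ⟩ := rowSum_option r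
  obtain ⟨κ, hκ⟩ := colSum_option c
  have hmid := mid_jm r c hinj hex
  have e1 : rowSum r * cycSum (Option α) N * colSum c =
      w • (rowSum r * ((N : ℚ) • 1 + jm α) * colSum c) := by
    have hc : ∀ y, ((N : ℚ) • 1 + jm α) * iotaO α y = iotaO α y * ((N : ℚ) • 1 + jm α) := by
      intro y; rw [add_mul, mul_add, jm_comm]; simp
    set R' := rowSum fun i => r (some i)
    set C' := colSum fun i => c (some i)
    set X := ((N : ℚ) • 1 + jm α)
    rw [cycSum_option, hρ, hκ]
    calc ρ * iotaO α R' * (X * iotaO α (cycSum α N)) * (iotaO α C' * κ)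
        = ρ * (iotaO α R' * X) * (iotaO α (cycSum α N) * iotaO α C') * κ := by noncomm_ring
      _ = ρ * X * iotaO α (R' * cycSum α N * C') * κ := by
          rw [← hc, map_mul, map_mul]; noncomm_ring
      _ = w • (ρ * (X * iotaO α R') * (iotaO α C') * κ) := by
          rw [h, map_smul, map_mul, mul_smul_comm, smul_mul_assoc]; congr 1; noncomm_ring
      _ = _ := by rw [hc]; congr 1; noncomm_ring
  rw [e1, mul_add, add_mul, hmid, mul_smul_comm, mul_one, smul_mul_assoc, ← add_smul, smul_smul]

lemma GoodT_empty [IsEmpty α] (r c : α → ℕ) (N : ℕ) : GoodT r c N 1 := by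
  unfold GoodT
  have : cycSum α N = 1 := by
    unfold cycSum fixCnt
    simp [Fintype.sum_unique]
    rfl
  rw [this]; simp

/-- renaming -/
noncomputable def trsp (e : α ≃ β) : GA α →ₐ[ℚ] GA β :=
  MonoidAlgebra.mapDomainAlgHom ℚ ℚ (e.permCongrHom.toMonoidHom)

lemma trsp_of (e : α ≃ β) (g : Perm α) :
    trsp e (MonoidAlgebra.of ℚ _ g) = MonoidAlgebra.of ℚ _ (e.permCongr g) := by
  simp [trsp, MonoidAlgebra.of]

lemma trsp_rowSum (e : α ≃ β) (r : β → ℕ) : trsp e (rowSum (r ∘ e)) = rowSum r := by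
  unfold rowSum
  rw [← Equiv.sum_comp e.permCongr, map_sum]
  refine Finset.sum_congr rfl fun g _ => ?_
  have : (∀ i, r (e.permCongr g i) = r i) ↔ ∀ i, (r ∘ e) (g i) = (r ∘ e) i := by
    rw [← e.forall_congr_right]; simp [Equiv.permCongr_apply]
  simp only [this, apply_ite (trsp e), trsp_of, map_zero]

lemma trsp_colSum (e : α ≃ β) (r : β → ℕ) : trsp e (colSum (r ∘ e)) = colSum r := by
  unfold colSum
  rw [← Equiv.sum_comp e.permCongr, map_sum]
  refine Finset.sum_congr rfl fun g _ => ?_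
  have : (∀ i, r (e.permCongr g i) = r i) ↔ ∀ i, (r ∘ e) (g i) = (r ∘ e) i := by
    rw [← e.forall_congr_right]; simp [Equiv.permCongr_apply]
  simp only [this, apply_ite (trsp e), map_smul, trsp_of, map_zero, Perm.sign_permCongr]

lemma fixCnt_congr (e : α ≃ β) (N : ℕ) (g : Perm α) : fixCnt N (e.permCongr g) = fixCnt N g := by
  unfold fixCnt
  refine Fintype.card_congr ⟨fun f => ⟨f.1 ∘ e, fun i => ?_⟩, fun f => ⟨f.1 ∘ e.symm, fun i => ?_⟩, ?_, ?_⟩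
  · have := f.2 (e i); simpa [Equiv.permCongr_apply] using this
  · have := f.2 (e.symm i); simpa [Equiv.permCongr_apply] using this
  · intro f; ext; simp
  · intro f; ext; simp

lemma trsp_cycSum (e : α ≃ β) (N : ℕ) : trsp e (cycSum α N) = cycSum β N := by
  unfold cycSum
  rw [← Equiv.sum_comp e.permCongr, map_sum]
  refine Finset.sum_congr rfl fun g _ => ?_
  rw [map_smul, trsp_of, fixCnt_congr]

lemma GoodT_congr (e : α ≃ β) (r c : β → ℕ) (N : ℕ) (w : ℚ) (h : GoodT (r ∘ e) (c ∘ e) N w) :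
    GoodT r c N w := by
  unfold GoodT at *
  have := congrArg (trsp e) h
  simpa only [map_mul, map_smul, trsp_rowSum, trsp_colSum, trsp_cycSum] using this

end part1

open Equiv

lemma GoodT_insert (t : Finset (ℕ × ℕ)) (x : ℕ × ℕ) (hx : x ∉ t)
    (hlow : IsLowerSet ((insert x t : Finset (ℕ × ℕ)) : Set (ℕ × ℕ)))
    (hmax : ∀ y ∈ t, y.1 < x.1 ∨ (y.1 = x.1 ∧ y.2 < x.2)) (N : ℕ) (w : ℚ)
    (h : GoodT (fun y : t => y.1.1) (fun y : t => y.1.2) N w) :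
    GoodT (fun y : (insert x t : Finset (ℕ × ℕ)) => y.1.1)
      (fun y : (insert x t : Finset (ℕ × ℕ)) => y.1.2) N (w * (N + ((x.2 : ℚ) - x.1))) := by
  have hmem : ∀ i j, i ≤ x.1 → j ≤ x.2 → (i, j) ≠ x → (i, j) ∈ t := by
    intro i j hi hj hne
    have : (i, j) ∈ ((insert x t : Finset (ℕ × ℕ)) : Set (ℕ × ℕ)) :=
      hlow (show (i, j) ≤ x from ⟨hi, hj⟩) (by simp)
    simpa [hne] using this
  apply GoodT_congr (Finset.subtypeInsertEquivOption hx).symm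
  have key := GoodT_option (α := t) 
    ((fun y : (insert x t : Finset (ℕ × ℕ)) => y.1.1) ∘ (Finset.subtypeInsertEquivOption hx).symm)
    ((fun y : (insert x t : Finset (ℕ × ℕ)) => y.1.2) ∘ (Finset.subtypeInsertEquivOption hx).symm) N w h ?_ ?_
  · have e1 : (Finset.univ.filter fun k : t => k.1.1 = x.1).card = x.2 := by
      rw [← Finset.card_range x.2]
      refine Finset.card_bij (fun k _ => k.1.2) ?_ ?_ ?_
      · intro k hk
        simp only [Finset.mem_filter, Finset.mem_univ, true_and] at hk
        have := hmax k.1 k.2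
        simp only [Finset.mem_range]; omega
      · intro k hk k' hk' he
        simp only [Finset.mem_filter, Finset.mem_univ, true_and] at hk hk'
        exact Subtype.ext (Prod.ext (hk.trans hk'.symm) he)
      · intro j hj
        simp only [Finset.mem_range] at hj
        refine ⟨⟨(x.1, j), hmem _ _ le_rfl hj.le ?_⟩, by simp, rfl⟩
        intro h; rw [← h] at hj; simp at hj
    have e2 : (Finset.univ.filter fun k : t => k.1.2 = x.2).card = x.1 := by
      rw [← Finset.card_range x.1]
      refine Finset.card_bij (fun k _ => k.1.1) ?_ ?_ ?_
      · intro k hk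
        simp only [Finset.mem_filter, Finset.mem_univ, true_and] at hk
        have := hmax k.1 k.2
        simp only [Finset.mem_range]; omega
      · intro k hk k' hk' he
        simp only [Finset.mem_filter, Finset.mem_univ, true_and] at hk hk'
        exact Subtype.ext (Prod.ext he (hk.trans hk'.symm))
      · intro j hj
        simp only [Finset.mem_range] at hj
        refine ⟨⟨(j, x.2), hmem _ _ hj.le le_rfl ?_⟩, by simp, rfl⟩
        intro h; rw [← h] at hj; simp at hj
    have e3 : ((Finset.univ.filter fun k : t => k.1.1 = x.1).card : ℚ) = x.2 := by exact_mod_cast e1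
    have e4 : ((Finset.univ.filter fun k : t => k.1.2 = x.2).card : ℚ) = x.1 := by exact_mod_cast e2
    have key2 : GoodT _ _ N (w * (N + (((Finset.univ.filter fun k : t => k.1.1 = x.1).card : ℚ) - ((Finset.univ.filter fun k : t => k.1.2 = x.2).card : ℚ)))) := key
    rw [e3, e4] at key2
    exact key2
  · rintro k ⟨h1, h2⟩
    apply hx
    have : k.1 = x := Prod.ext h1 h2
    rw [← this]; exact k.2
  · intro k h1 h2
    have h1' : k.1.1 ≠ x.1 := h1
    have := hmax k.1 k.2
    refine ⟨⟨(k.1.1, x.2), hmem _ _ (by omega) le_rfl ?_⟩, rfl, rfl⟩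
    intro h; rw [← h] at h1'; exact h1' rfl

lemma GoodT_lower (N : ℕ) (n : ℕ) : ∀ S : Finset (ℕ × ℕ), S.card = n → IsLowerSet (S : Set (ℕ × ℕ)) →
    GoodT (fun y : S => y.1.1) (fun y : S => y.1.2) N (∏ x ∈ S, ((N : ℚ) + ((x.2 : ℚ) - x.1))) := by
  induction n with
  | zero =>
    intro S hS _
    rw [Finset.card_eq_zero] at hS
    subst hS
    rw [Finset.prod_empty]
    exact GoodT_empty _ _ _
  | succ n ih =>
    intro S hS hlow
    obtain ⟨x, hxS, hx⟩ := Finset.exists_max_image S (fun x => toLex x)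
      (Finset.card_pos.mp (by omega))
    have hmax : ∀ y ∈ S.erase x, y.1 < x.1 ∨ (y.1 = x.1 ∧ y.2 < x.2) := by
      intro y hy
      have h1 := hx y (Finset.mem_of_mem_erase hy)
      have h2 := Finset.ne_of_mem_erase hy
      rw [Prod.Lex.toLex_le_toLex] at h1
      rcases h1 with h1 | ⟨h1, h3⟩
      · exact Or.inl h1
      · refine Or.inr ⟨h1, lt_of_le_of_ne h3 fun h => h2 (Prod.ext h1 h)⟩
    have hl : IsLowerSet ((S.erase x : Finset (ℕ × ℕ)) : Set (ℕ × ℕ)) := by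
      intro a b hab ha
      simp only [Finset.coe_erase, Set.mem_sdiff, Finset.mem_coe, Set.mem_singleton_iff] at ha ⊢
      refine ⟨hlow hab ha.1, ?_⟩
      rintro rfl
      have := hmax a (Finset.mem_erase.mpr ⟨ha.2, ha.1⟩)
      have h1 := hab.1
      have h2 := hab.2
      omega
    have h := ih (S.erase x) (by rw [Finset.card_erase_of_mem hxS, hS]; rfl) hl
    have hins : insert x (S.erase x) = S := Finset.insert_erase hxS
    have := GoodT_insert (S.erase x) x (Finset.notMem_erase _ _) (by rw [hins]; exact hlow) hmax N _ h
    rw [hins] at this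
    rw [← Finset.prod_erase_mul _ _ hxS]
    exact this

lemma fixCnt_conj {α : Type} [Fintype α] [DecidableEq α] (N : ℕ) (g h : Perm α) : fixCnt N (h * g * h⁻¹) = fixCnt N g := by
  have := fixCnt_congr h N g
  rw [← this]
  congr 1


open Equiv

noncomputable def maBasis (G : Type) [Group G] : Module.Basis G ℚ (MonoidAlgebra ℚ G) :=
  Module.Basis.ofRepr
    { toFun := fun y => y.coeff
      invFun := fun y => ⟨y⟩
      map_add' := fun x y => rfl
      map_smul' := fun x y => rfl
      left_inv := fun x => rfl
      right_inv := fun x => rfl }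

lemma maBasis_repr {G : Type} [Group G] (y : MonoidAlgebra ℚ G) (g : G) :
    (maBasis G).repr y g = y.coeff g := rfl

lemma maBasis_apply {G : Type} [Group G] (g : G) :
    maBasis G g = MonoidAlgebra.of ℚ G g := by
  apply (maBasis G).repr.injective
  ext h
  rw [Module.Basis.repr_self, maBasis_repr]
  rfl

def ctr (G : Type) [Group G] : Submodule ℚ (MonoidAlgebra ℚ G) where
  carrier := {y | ∀ g, MonoidAlgebra.of ℚ G g * y * MonoidAlgebra.of ℚ G g⁻¹ = y}
  add_mem' := by
    intro a b ha hb g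
    rw [mul_add, add_mul, ha g, hb g]
  zero_mem' := by intro g; simp
  smul_mem' := by
    intro c x hx g
    rw [mul_smul_comm, smul_mul_assoc, hx g]

lemma coeff_conj {G : Type} [Group G] (g x : G) (y : MonoidAlgebra ℚ G) :
    (MonoidAlgebra.of ℚ G g * y * MonoidAlgebra.of ℚ G g⁻¹).coeff x = y.coeff (g⁻¹ * x * g) := by
  simp [MonoidAlgebra.of, mul_assoc]

lemma ctr_finrank (G : Type) [Group G] [Fintype G] :
    Module.finrank ℚ (ctr G) ≤ Nat.card (ConjClasses G) := by
  classical
  haveI : Finite (ConjClasses G) := Quotient.finite _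
  haveI := Fintype.ofFinite (ConjClasses G)
  let f : ctr G →ₗ[ℚ] (ConjClasses G → ℚ) :=
    { toFun := fun y c => y.1.coeff (Quotient.out c)
      map_add' := fun x y => rfl
      map_smul' := fun x y => rfl }
  have hf : Function.Injective f := by
    rw [injective_iff_map_eq_zero]
    intro y hy
    ext1
    apply (maBasis G).repr.injective
    ext h
    rw [maBasis_repr]
    have h1 : IsConj h (Quotient.out (ConjClasses.mk h)) := by
      rw [← ConjClasses.mk_eq_mk_iff_isConj]
      exact (Quotient.out_eq (ConjClasses.mk h)).symm
    obtain ⟨c, hc⟩ := isConj_iff.mp h1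
    have h2 := congrFun hy (ConjClasses.mk h)
    have h3 := y.2 c⁻¹
    have h4 : y.1.coeff h = y.1.coeff (Quotient.out (ConjClasses.mk h)) := by
      rw [← hc]
      conv_lhs => rw [← h3]
      rw [coeff_conj]; simp
    rw [h4]; exact h2
  have := LinearMap.finrank_le_finrank_of_injective hf
  simpa [Module.finrank_fintype_fun_eq_card, Nat.card_eq_fintype_card] using this

/-- trace lemma -/
lemma trace_lemma {G Λ : Type} [Group G] [Fintype G] [Fintype Λ] (P : MonoidAlgebra ℚ G)
    (hP : ∀ g, MonoidAlgebra.of ℚ G g * P = P * MonoidAlgebra.of ℚ G g)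
    (hcard : Nat.card (ConjClasses G) ≤ Fintype.card Λ)
    (z : Λ → MonoidAlgebra ℚ G) (hz0 : ∀ l, z l ≠ 0)
    (hz : ∀ l g, MonoidAlgebra.of ℚ G g * z l * MonoidAlgebra.of ℚ G g⁻¹ = z l)
    (w : Λ → ℚ) (hw : Function.Injective w) (hPz : ∀ l, P * z l = w l • z l) :
    ∑ s : G, ∑ t : G, P.coeff (s * t * s⁻¹ * t⁻¹) = (Fintype.card G : ℚ) * ∑ l, w l := by
  classical
  haveI : Module.Finite ℚ (MonoidAlgebra ℚ G) := Module.Finite.of_basis (maBasis G)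
  let F0 : MonoidAlgebra ℚ G →ₗ[ℚ] MonoidAlgebra ℚ G :=
    { toFun := fun y => ∑ t : G, MonoidAlgebra.of ℚ G t * (P * y) * MonoidAlgebra.of ℚ G t⁻¹
      map_add' := by
        intro x y
        simp only [mul_add, add_mul, Finset.sum_add_distrib]
      map_smul' := by
        intro c x
        simp only [mul_smul_comm, smul_mul_assoc, Finset.smul_sum, RingHom.id_apply] }
  have hF0 : ∀ y, F0 y ∈ ctr G := by
    intro y g
    show MonoidAlgebra.of ℚ G g * (∑ t : G, _) * _ = ∑ t : G, _
    rw [Finset.mul_sum, Finset.sum_mul]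
    rw [← Equiv.sum_comp (Equiv.mulLeft g) (fun t => MonoidAlgebra.of ℚ G t * (P * y) * MonoidAlgebra.of ℚ G t⁻¹)]
    refine Finset.sum_congr rfl fun t _ => ?_
    simp only [Equiv.coe_mulLeft, mul_inv_rev, map_mul, mul_assoc]
  let F : MonoidAlgebra ℚ G →ₗ[ℚ] ctr G := F0.codRestrict (ctr G) hF0
  have key := LinearMap.trace_comp_comm' (R := ℚ) F (ctr G).subtype
  have e1 : (ctr G).subtype ∘ₗ F = F0 := by ext1; rfl
  rw [e1, LinearMap.trace_eq_matrix_trace ℚ (maBasis G)] at key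
  let z' : Λ → ctr G := fun l => ⟨z l, hz l⟩
  have hcG : (Fintype.card G : ℚ) ≠ 0 := by exact_mod_cast Fintype.card_ne_zero
  have hev : ∀ l, (F ∘ₗ (ctr G).subtype) (z' l) = ((Fintype.card G : ℚ) * w l) • z' l := by
    intro l
    ext1
    show (∑ t : G, MonoidAlgebra.of ℚ G t * (P * z l) * MonoidAlgebra.of ℚ G t⁻¹) = _ • z l
    simp only [hPz, mul_smul_comm, smul_mul_assoc, hz]
    rw [Finset.sum_const, Finset.card_univ, ← Nat.cast_smul_eq_nsmul ℚ, mul_smul]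
  have hli : LinearIndependent ℚ z' := by
    refine Module.End.eigenvectors_linearIndependent' (F ∘ₗ (ctr G).subtype) (fun l => (Fintype.card G : ℚ) * w l) ?_ z' ?_
    · intro l m h; exact hw (mul_left_cancel₀ hcG h)
    · intro l
      rw [Module.End.hasEigenvector_iff, Module.End.mem_eigenspace_iff]
      refine ⟨hev l, fun h => hz0 l ?_⟩
      exact congrArg Subtype.val h
  have hle := hli.fintype_card_le_finrank
  have hfr : Fintype.card Λ = Module.finrank ℚ (ctr G) := le_antisymm hle ((ctr_finrank G).trans hcard)
  haveI : Nonempty Λ := by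
    rw [← Fintype.card_pos_iff]
    refine lt_of_lt_of_le ?_ hcard
    haveI : Finite (ConjClasses G) := Quotient.finite _
    haveI : Nonempty (ConjClasses G) := ⟨1⟩
    exact Nat.card_pos
  let b := basisOfLinearIndependentOfCardEqFinrank hli hfr
  have hb : ∀ l, b l = z' l := fun l => by simp [b]
  rw [LinearMap.trace_eq_matrix_trace ℚ b (F ∘ₗ (ctr G).subtype)] at key
  have r1 : Matrix.trace (LinearMap.toMatrix b b (F ∘ₗ (ctr G).subtype)) = (Fintype.card G : ℚ) * ∑ l, w l := by
    unfold Matrix.trace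
    rw [Finset.mul_sum]
    refine Finset.sum_congr rfl fun l _ => ?_
    rw [Matrix.diag_apply, LinearMap.toMatrix_apply, hb, hev, ← hb]
    simp
  have l1 : Matrix.trace (LinearMap.toMatrix (maBasis G) (maBasis G) F0) = ∑ s : G, ∑ t : G, P.coeff (s * t * s⁻¹ * t⁻¹) := by
    unfold Matrix.trace
    rw [Finset.sum_comm]
    refine Finset.sum_congr rfl fun s _ => ?_
    rw [Matrix.diag_apply, LinearMap.toMatrix_apply, maBasis_apply]
    show (maBasis G).repr (∑ t : G, _) s = _
    rw [map_sum, Finsupp.finsetSum_apply, ← Equiv.sum_comp (Equiv.inv G)]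
    refine Finset.sum_congr rfl fun t _ => ?_
    rw [maBasis_repr, coeff_conj]
    simp [MonoidAlgebra.of]
  rw [← l1, ← r1, key]

open Equiv

open Classical in
noncomputable def LS (n : ℕ) : Finset (Finset (ℕ × ℕ)) :=
  ((Finset.range n ×ˢ Finset.range n).powerset).filter
    (fun S => S.card = n ∧ IsLowerSet (S : Set (ℕ × ℕ)))

lemma lower_sub {S : Finset (ℕ × ℕ)} (h : IsLowerSet (S : Set (ℕ × ℕ))) {i j : ℕ} (hx : (i, j) ∈ S) :
    i < S.card ∧ j < S.card := by
  constructor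
  · have : (Finset.range (i+1)).image (fun k => (k, j)) ⊆ S := by
      intro x hx'
      simp only [Finset.mem_image, Finset.mem_range] at hx'
      obtain ⟨k, hk, rfl⟩ := hx'
      exact h (show (k, j) ≤ (i, j) from ⟨by simp; omega, le_refl _⟩) hx
    have h2 := Finset.card_le_card this
    rw [Finset.card_image_of_injective _ (fun a b hab => by simpa using hab), Finset.card_range] at h2
    omega
  · have : (Finset.range (j+1)).image (fun k => (i, k)) ⊆ S := by
      intro x hx'
      simp only [Finset.mem_image, Finset.mem_range] at hx'
      obtain ⟨k, hk, rfl⟩ := hx'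
      exact h (show (i, k) ≤ (i, j) from ⟨le_refl _, by simp; omega⟩) hx
    have h2 := Finset.card_le_card this
    rw [Finset.card_image_of_injective _ (fun a b hab => by simpa using hab), Finset.card_range] at h2
    omega

lemma mem_LS {n : ℕ} {S : Finset (ℕ × ℕ)} : S ∈ LS n ↔ S.card = n ∧ IsLowerSet (S : Set (ℕ × ℕ)) := by
  classical
  unfold LS
  rw [Finset.mem_filter, Finset.mem_powerset]
  constructor
  · exact fun h => h.2
  · rintro ⟨h1, h2⟩
    refine ⟨?_, h1, h2⟩
    rintro ⟨i, j⟩ hx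
    have := lower_sub h2 hx
    simp; omega

/-- diagram of a multiset -/
def dgm (n : ℕ) (s : Multiset ℕ) : Finset (ℕ × ℕ) :=
  (Finset.range n ×ˢ Finset.range n).filter (fun x => x.1 < (s.filter (fun p => x.2 < p)).card)

lemma sum_filter_card (n : ℕ) (s : Multiset ℕ) (hs : ∀ p ∈ s, p ≤ n) :
    ∑ j ∈ Finset.range n, (s.filter (fun p => j < p)).card = s.sum := by
  induction s using Multiset.induction with
  | empty => simp
  | cons p s ih =>
    have ih' := ih (fun q hq => hs q (Multiset.mem_cons_of_mem hq))
    have hp := hs p (Multiset.mem_cons_self p s)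
    rw [Multiset.sum_cons, ← ih']
    have : ∀ j, ((p ::ₘ s).filter (fun p => j < p)).card = (if j < p then 1 else 0) + (s.filter (fun p => j < p)).card := by
      intro j
      rw [Multiset.filter_cons]
      split_ifs <;> simp [add_comm]
    simp only [this, Finset.sum_add_distrib]
    congr 1
    rw [Finset.sum_ite, Finset.sum_const_zero, add_zero, Finset.sum_const, smul_eq_mul, mul_one]
    have : (Finset.range n).filter (fun j => j < p) = Finset.range p := by
      ext j; simp; omega
    rw [this, Finset.card_range]

lemma card_le_sum_pos (s : Multiset ℕ) (hs : ∀ p ∈ s, 0 < p) : s.card ≤ s.sum := by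
  induction s using Multiset.induction with
  | empty => simp
  | cons p s ih =>
    have ih' := ih (fun q hq => hs q (Multiset.mem_cons_of_mem hq))
    have hp := hs p (Multiset.mem_cons_self p s)
    simp; omega

lemma dgm_mem (n : ℕ) (p : n.Partition) : dgm n p.parts ∈ LS n := by
  have hc : ∀ j, (p.parts.filter (fun q => j < q)).card ≤ n := fun j => by
    refine (Multiset.card_le_card (Multiset.filter_le _ _)).trans ?_
    have := card_le_sum_pos p.parts (fun q hq => p.parts_pos hq)
    rwa [p.parts_sum] at this
  have hle : ∀ q ∈ p.parts, q ≤ n := fun q hq => by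
    have := Multiset.le_sum_of_mem hq
    rwa [p.parts_sum] at this
  rw [mem_LS]
  constructor
  · unfold dgm
    rw [Finset.card_filter, Finset.sum_product_right]
    have : ∀ j ∈ Finset.range n, (∑ i ∈ Finset.range n, if i < (p.parts.filter (fun q => j < q)).card then 1 else 0) = (p.parts.filter (fun q => j < q)).card := by
      intro j _
      rw [Finset.sum_ite, Finset.sum_const_zero, add_zero, Finset.sum_const, smul_eq_mul, mul_one]
      have : (Finset.range n).filter (fun i => i < (p.parts.filter (fun q => j < q)).card) = Finset.range (p.parts.filter (fun q => j < q)).card := by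
        ext i; have := hc j; simp; omega
      rw [this, Finset.card_range]
    rw [Finset.sum_congr rfl this, sum_filter_card n _ hle, p.parts_sum]
  · rintro ⟨i, j⟩ ⟨i', j'⟩ hle' hx
    have h1 : i' ≤ i := hle'.1
    have h2 : j' ≤ j := hle'.2
    simp only [dgm, Finset.coe_filter, Finset.mem_product, Finset.mem_range, Set.mem_setOf_eq] at hx ⊢
    refine ⟨by omega, lt_of_le_of_lt h1 (lt_of_lt_of_le hx.2 ?_)⟩
    exact Multiset.card_le_card (Multiset.monotone_filter_right _ (fun q hq => by omega))

lemma dgm_inj (n : ℕ) : Function.Injective (fun p : n.Partition => dgm n p.parts) := by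
  intro p q h
  have hc : ∀ (p : n.Partition) j, (p.parts.filter (fun q => j < q)).card ≤ n := fun p j => by
    refine (Multiset.card_le_card (Multiset.filter_le _ _)).trans ?_
    have := card_le_sum_pos p.parts (fun q hq => p.parts_pos hq)
    rwa [p.parts_sum] at this
  have hle : ∀ (p : n.Partition), ∀ q ∈ p.parts, q ≤ n := fun p q hq => by
    have := Multiset.le_sum_of_mem hq
    rwa [p.parts_sum] at this
  have key : ∀ j, (p.parts.filter (fun q => j < q)).card = (q.parts.filter (fun q => j < q)).card := by
    intro j
    by_cases hj : j < n
    · by_contra hne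
      have hm : ∀ i < n, i < (p.parts.filter (fun q => j < q)).card ↔ i < (q.parts.filter (fun q => j < q)).card := by
        intro i hi
        have := congrArg (fun S => (i, j) ∈ S) h
        simpa [dgm, hi, hj] using this
      have h1 := hc p j
      have h2 := hc q j
      rcases lt_or_gt_of_ne hne with h3 | h3
      · have := (hm _ (lt_of_lt_of_le h3 h2)).mpr h3
        omega
      · have := (hm _ (lt_of_lt_of_le h3 h1)).mp h3
        omega
    · rw [Multiset.filter_eq_nil.mpr, Multiset.filter_eq_nil.mpr]
      · intro a ha; have := hle q a ha; omega
      · intro a ha; have := hle p a ha; omega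
  have cnt : ∀ (s : Multiset ℕ) j, s.count (j+1) + (s.filter (fun q => j + 1 < q)).card = (s.filter (fun q => j < q)).card := by
    intro s j
    rw [Multiset.count_eq_card_filter_eq, ← Multiset.card_add, Multiset.filter_add_filter]
    have e1 : s.filter (fun a => j + 1 = a ∧ j + 1 < a) = 0 := Multiset.filter_eq_nil.mpr (fun a _ => by omega)
    rw [e1, add_zero]
    congr 1
    refine Multiset.filter_congr (fun a _ => by omega)
  ext a
  rcases a with _ | j
  · rw [Multiset.count_eq_zero.mpr, Multiset.count_eq_zero.mpr]
    · intro h; exact absurd (q.parts_pos h) (by simp)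
    · intro h; exact absurd (p.parts_pos h) (by simp)
  · have h1 := cnt p.parts j
    have h2 := cnt q.parts j
    rw [key j, key (j+1)] at h1
    omega

lemma card_conj_le (n : ℕ) : Nat.card (ConjClasses (Perm (Fin n))) ≤ Fintype.card (LS n) := by
  classical
  let f : ConjClasses (Perm (Fin n)) → n.Partition := fun c =>
    { parts := (Quotient.out c).partition.parts
      parts_pos := fun h => (Quotient.out c).partition.parts_pos h
      parts_sum := by rw [(Quotient.out c).partition.parts_sum, Fintype.card_fin] }
  have hf : Function.Injective f := by
    intro c d h
    have h1 : (Quotient.out c).partition = (Quotient.out d).partition := by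
      apply Nat.Partition.ext; exact congrArg (fun p : n.Partition => p.parts) h
    have h2 := Equiv.Perm.partition_eq_of_isConj.mpr h1
    rw [← ConjClasses.mk_eq_mk_iff_isConj] at h2
    exact (Quotient.out_eq c).symm.trans (h2.trans (Quotient.out_eq d))
  rw [← Nat.card_eq_fintype_card]
  refine Nat.card_le_card_of_injective (fun c => (⟨dgm n (f c).parts, dgm_mem n (f c)⟩ : LS n)) ?_
  intro c d h
  exact hf (dgm_inj n (congrArg Subtype.val h))

open Equiv

noncomputable def cpoly (S : Finset (ℕ × ℕ)) : Polynomial ℚ :=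
  ∏ x ∈ S, (Polynomial.X + Polynomial.C ((x.2 : ℚ) - x.1))

lemma cpoly_roots (S : Finset (ℕ × ℕ)) : (cpoly S).roots = S.val.map (fun x => (x.1 : ℚ) - x.2) := by
  have : cpoly S = ((S.val.map (fun x : ℕ × ℕ => (x.1 : ℚ) - x.2)).map (fun a => Polynomial.X - Polynomial.C a)).prod := by
    unfold cpoly
    rw [Multiset.map_map]
    refine Finset.prod_congr rfl fun x _ => ?_
    simp [sub_eq_add_neg, add_comm]
  rw [this, Polynomial.roots_multiset_prod_X_sub_C]

lemma mem_iff_diag {S : Finset (ℕ × ℕ)} (h : IsLowerSet (S : Set (ℕ × ℕ))) (i j : ℕ) :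
    (i, j) ∈ S ↔ min i j < (S.filter (fun x => (i : ℚ) - j = (x.1 : ℚ) - x.2)).card := by
  have hcast : ∀ x : ℕ × ℕ, ((i : ℚ) - j = (x.1 : ℚ) - x.2) ↔ i + x.2 = x.1 + j := by
    intro x
    rw [sub_eq_sub_iff_add_eq_add]
    exact_mod_cast Iff.rfl
  simp only [hcast]
  constructor
  · intro hij
    have hsub : (Finset.range (min i j + 1)).image (fun k => (i - k, j - k)) ⊆ S.filter (fun x => i + x.2 = x.1 + j) := by
      intro x hx
      simp only [Finset.mem_image, Finset.mem_range] at hx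
      obtain ⟨k, hk, rfl⟩ := hx
      rw [Finset.mem_filter]
      exact ⟨h (show (i-k, j-k) ≤ (i, j) from ⟨by simp, by simp⟩) hij, by simp; omega⟩
    have h2 := Finset.card_le_card hsub
    rw [Finset.card_image_of_injOn, Finset.card_range] at h2
    · omega
    · intro a ha b hb hab
      simp at ha hb hab
      omega
  · intro hlt
    by_contra hij
    have hsub : (S.filter (fun x => i + x.2 = x.1 + j)).image (fun x => min x.1 x.2) ⊆ Finset.range (min i j) := by
      intro m hm
      simp only [Finset.mem_image, Finset.mem_filter] at hm
      obtain ⟨⟨i', j'⟩, ⟨hx, he⟩, rfl⟩ := hm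
      rw [Finset.mem_range]
      by_contra hge
      simp only at he hge
      exact hij (h (show (i, j) ≤ (i', j') from ⟨by simp; omega, by simp; omega⟩) hx)
    have h2 := Finset.card_le_card hsub
    rw [Finset.card_image_of_injOn, Finset.card_range] at h2
    · omega
    · rintro ⟨a, b⟩ ha ⟨c, d⟩ hb hab
      simp at ha hb hab ⊢
      omega

lemma cpoly_inj {S T : Finset (ℕ × ℕ)} (hS : IsLowerSet (S : Set (ℕ × ℕ))) (hT : IsLowerSet (T : Set (ℕ × ℕ)))
    (h : cpoly S = cpoly T) : S = T := by
  have h1 : S.val.map (fun x => (x.1 : ℚ) - x.2) = T.val.map (fun x => (x.1 : ℚ) - x.2) := by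
    rw [← cpoly_roots, ← cpoly_roots, h]
  ext ⟨i, j⟩
  rw [mem_iff_diag hS, mem_iff_diag hT]
  have h2 := congrArg (Multiset.count ((i : ℚ) - j)) h1
  rw [Multiset.count_map, Multiset.count_map] at h2
  show _ < Multiset.card (Multiset.filter _ _) ↔ _ < Multiset.card (Multiset.filter _ _)
  rw [h2]

lemma cpoly_eval (S : Finset (ℕ × ℕ)) (N : ℚ) : (cpoly S).eval N = ∏ x ∈ S, (N + ((x.2 : ℚ) - x.1)) := by
  unfold cpoly
  rw [Polynomial.eval_prod]
  simp

lemma good_N (n : ℕ) : {N : ℕ | Function.Injective (fun S : LS n => (cpoly S.1).eval (N : ℚ))}.Infinite := by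
  have hfin : (⋃ p : LS n × LS n, {N : ℕ | p.1 ≠ p.2 ∧ (cpoly p.1.1).eval (N : ℚ) = (cpoly p.2.1).eval (N : ℚ)}).Finite := by
    refine Set.finite_iUnion fun p => ?_
    by_cases hp : p.1 = p.2
    · simp [hp]
    · have hne : cpoly p.1.1 - cpoly p.2.1 ≠ 0 := by
        rw [sub_ne_zero]
        intro h
        exact hp (Subtype.ext (cpoly_inj (mem_LS.mp p.1.2).2 (mem_LS.mp p.2.2).2 h))
      have := (Polynomial.finite_setOf_isRoot hne).preimage (f := fun N : ℕ => (N : ℚ)) (Nat.cast_injective.injOn)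
      refine this.subset ?_
      rintro N ⟨_, hN⟩
      simp [Polynomial.IsRoot, hN]
  refine hfin.infinite_compl.mono ?_
  intro N hN S T h
  by_contra hne
  exact hN (Set.mem_iUnion.mpr ⟨(S, T), hne, h⟩)

section zz
variable {α : Type} [Fintype α] [DecidableEq α]

lemma coeff_of' (g h : Perm α) : (MonoidAlgebra.of ℚ (Perm α) g).coeff h = if g = h then 1 else 0 := by
  simp [MonoidAlgebra.of, Finsupp.single_apply]

lemma coeff_sum' {ι : Type*} (s : Finset ι) (f : ι → GA α) (h : Perm α) : (∑ i ∈ s, f i).coeff h = ∑ i ∈ s, (f i).coeff h := by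
  classical
  induction s using Finset.induction with
  | empty => rfl
  | insert a s ha ih => rw [Finset.sum_insert ha, Finset.sum_insert ha, ← ih]; rfl

lemma coeff_smul' (c : ℚ) (f : GA α) (h : Perm α) : (c • f).coeff h = c * f.coeff h := rfl

lemma cycSum_coeff (N : ℕ) (g : Perm α) : (cycSum α N).coeff g = fixCnt N g := by
  unfold cycSum
  rw [coeff_sum']
  simp only [coeff_smul', coeff_of']
  simp

lemma cycSum_comm (N : ℕ) (g : Perm α) :
    MonoidAlgebra.of ℚ _ g * cycSum α N = cycSum α N * MonoidAlgebra.of ℚ _ g := by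
  unfold cycSum
  rw [Finset.mul_sum, Finset.sum_mul, ← Equiv.sum_comp (MulAut.conj g).toEquiv
    (fun h => ((fixCnt N h : ℚ) • MonoidAlgebra.of ℚ (Perm α) h) * MonoidAlgebra.of ℚ (Perm α) g)]
  refine Finset.sum_congr rfl fun h _ => ?_
  have : (MulAut.conj g).toEquiv h = g * h * g⁻¹ := rfl
  rw [this, fixCnt_conj, mul_smul_comm, smul_mul_assoc, ← map_mul, ← map_mul]
  simp

lemma cycSum_central (N : ℕ) (y : GA α) : y * cycSum α N = cycSum α N * y := by
  induction y using MonoidAlgebra.induction_on with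
  | of g => exact cycSum_comm N g
  | add a b ha hb => rw [add_mul, mul_add, ha, hb]
  | smul r a ha => rw [smul_mul_assoc, mul_smul_comm, ha]

lemma ab_coeff_one (r c : α → ℕ) (hinj : ∀ i j, r i = r j → c i = c j → i = j) :
    (rowSum r * colSum c).coeff 1 = 1 := by
  unfold rowSum
  rw [Finset.sum_mul, coeff_sum', Finset.sum_eq_single 1]
  · simp only [Perm.coe_one, id_eq, implies_true, if_true, map_one, one_mul]
    unfold colSum
    rw [coeff_sum', Finset.sum_eq_single 1]
    · simp
    · intro g _ hg
      split_ifs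
      · rw [coeff_smul', coeff_of', if_neg hg, mul_zero]
      · rfl
    · simp
  · intro g _ hg
    split_ifs with h
    · have e : (MonoidAlgebra.of ℚ _ g * colSum c).coeff 1 = (colSum c).coeff g⁻¹ := by
        simp [MonoidAlgebra.of]
      rw [e]
      unfold colSum
      rw [coeff_sum']
      refine Finset.sum_eq_zero fun k _ => ?_
      split_ifs with h2
      · rw [coeff_smul', coeff_of', if_neg, mul_zero]
        rintro rfl
        apply hg
        ext1 i
        refine hinj _ _ (h i) ?_
        have := h2 (g i)
        simpa using this.symm
      · rfl
    · rw [zero_mul]; rfl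
  · simp

noncomputable def zel (r c : α → ℕ) : GA α :=
  ∑ g : Perm α, MonoidAlgebra.of ℚ _ g * (rowSum r * colSum c) * MonoidAlgebra.of ℚ _ g⁻¹

lemma zel_ne (r c : α → ℕ) (hinj : ∀ i j, r i = r j → c i = c j → i = j) : zel r c ≠ 0 := by
  intro h
  have h1 : (zel r c).coeff 1 = 0 := by rw [h]; rfl
  unfold zel at h1
  rw [coeff_sum'] at h1
  simp only [coeff_conj, mul_one, inv_mul_cancel, ab_coeff_one r c hinj] at h1
  simp [Fintype.card_ne_zero] at h1

lemma zel_conj (r c : α → ℕ) (g : Perm α) :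
    MonoidAlgebra.of ℚ _ g * zel r c * MonoidAlgebra.of ℚ _ g⁻¹ = zel r c := by
  unfold zel
  rw [Finset.mul_sum, Finset.sum_mul]
  rw [← Equiv.sum_comp (Equiv.mulLeft g) (fun t => MonoidAlgebra.of ℚ (Perm α) t * (rowSum r * colSum c) * MonoidAlgebra.of ℚ _ t⁻¹)]
  refine Finset.sum_congr rfl fun t _ => ?_
  simp only [Equiv.coe_mulLeft, mul_inv_rev, map_mul, mul_assoc]

lemma zel_eig (r c : α → ℕ) (N : ℕ) (w : ℚ) (h : GoodT r c N w) :
    cycSum α N * zel r c = w • zel r c := by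
  unfold zel
  rw [Finset.mul_sum, Finset.smul_sum]
  refine Finset.sum_congr rfl fun g _ => ?_
  unfold GoodT at h
  rw [← mul_assoc, ← mul_assoc, ← cycSum_comm, mul_assoc _ (cycSum α N), ← mul_assoc (cycSum α N), ← cycSum_central, h]
  rw [mul_smul_comm, smul_mul_assoc]

end zz

lemma main_eval (n N : ℕ) (hN : Function.Injective (fun S : LS n => (cpoly S.1).eval (N : ℚ))) :
    ∑ s : Perm (Fin n), ∑ t : Perm (Fin n), (fixCnt N (s * t * s⁻¹ * t⁻¹) : ℚ) =
      (n.factorial : ℚ) * ∑ S ∈ LS n, (cpoly S).eval (N : ℚ) := by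
  classical
  have e : ∀ S : LS n, S.1 ≃ Fin n := fun S => Finset.equivFinOfCardEq (mem_LS.mp S.2).1
  have h := trace_lemma (G := Perm (Fin n)) (Λ := LS n) (cycSum (Fin n) N) (cycSum_comm N) (card_conj_le n)
    (fun S => zel (fun i => ((e S).symm i).1.1) (fun i => ((e S).symm i).1.2))
    (fun S => zel_ne _ _ (fun i j h1 h2 => (e S).symm.injective (Subtype.ext (Prod.ext h1 h2))))
    (fun S g => zel_conj _ _ g) (fun S => (cpoly S.1).eval (N : ℚ)) hN
    (fun S => by
      refine zel_eig _ _ _ _ ?_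
      refine GoodT_congr (e S) _ _ N _ ?_
      have := GoodT_lower N n S.1 (mem_LS.mp S.2).1 (mem_LS.mp S.2).2
      rw [cpoly_eval]
      convert this using 1
      · ext y; simp
      · ext y; simp)
  simp only [cycSum_coeff] at h
  rw [h, Fintype.card_perm, Fintype.card_fin, Finset.sum_coe_sort (LS n) (fun S => (cpoly S).eval (N : ℚ))]

open Equiv

section fc
variable {n : ℕ}

def kap (g : Perm (Fin n)) (i : Fin n) : g.cycleFactorsFinset ⊕ {i : Fin n // g i = i} :=
  if h : g i = i then Sum.inr ⟨i, h⟩ else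
    Sum.inl ⟨g.cycleOf i, Perm.cycleOf_mem_cycleFactorsFinset_iff.mpr (Perm.mem_support.mpr h)⟩

lemma kap_inv (g : Perm (Fin n)) (i : Fin n) : kap g (g i) = kap g i := by
  unfold kap
  by_cases h : g i = i
  · simp [h]
  · have h' : g (g i) ≠ g i := fun e => h (g.injective e)
    rw [dif_neg h, dif_neg h']
    simp [Perm.cycleOf_apply_self, Perm.SameCycle.cycleOf_eq (show g.SameCycle (g i) i from Perm.sameCycle_apply_left.mpr (Perm.SameCycle.refl g i))]

lemma kap_same (g : Perm (Fin n)) (i j : Fin n) (h : kap g i = kap g j) : g.SameCycle i j := by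
  unfold kap at h
  split_ifs at h with h1 h2 h2
  · have := Subtype.mk.inj (Sum.inr.inj h)
    rw [this]
  · have := Subtype.mk.inj (Sum.inl.inj h)
    exact (Perm.sameCycle_iff_cycleOf_eq_of_mem_support (Perm.mem_support.mpr h1) (Perm.mem_support.mpr h2)).mpr this

lemma kap_surj (g : Perm (Fin n)) : Function.Surjective (kap g) := by
  rintro (⟨c, hc⟩ | ⟨i, hi⟩)
  · have hc' := Perm.mem_cycleFactorsFinset_iff.mp hc
    obtain ⟨i, hi, _⟩ := hc'.1
    have hs : i ∈ c.support := Perm.mem_support.mpr hi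
    refine ⟨i, ?_⟩
    have hg : g i ≠ i := by rw [← hc'.2 i hs]; exact hi
    unfold kap
    rw [dif_neg hg]
    congr 2
    exact (Perm.cycle_is_cycleOf hs hc).symm
  · exact ⟨i, by simp [kap, hi]⟩

lemma fixCnt_eq (N : ℕ) (g : Perm (Fin n)) : fixCnt N g = N ^ numCycles g := by
  have hK : Fintype.card (g.cycleFactorsFinset ⊕ {i : Fin n // g i = i}) = numCycles g := by
    rw [Fintype.card_sum, Fintype.card_coe, Fintype.card_subtype]
    unfold numCycles
    rw [Perm.cycleType_def, Multiset.card_map]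
    rfl
  rw [← hK]
  have : N ^ Fintype.card (g.cycleFactorsFinset ⊕ {i : Fin n // g i = i}) = Fintype.card ((g.cycleFactorsFinset ⊕ {i : Fin n // g i = i}) → Fin N) := by
    rw [Fintype.card_fun, Fintype.card_fin]
  rw [this]
  unfold fixCnt
  symm
  rw [← Nat.card_eq_fintype_card, ← @Nat.card_eq_fintype_card _ (_)]
  refine Nat.card_eq_of_bijective (f := fun h => ⟨h ∘ kap g, fun i => by simp [kap_inv]⟩) ⟨?_, ?_⟩
  · intro h1 h2 h
    have := Subtype.mk.inj h
    exact (kap_surj g).injective_comp_right this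
  · rintro ⟨f, hf⟩
    have hz : ∀ i j, g.SameCycle i j → f i = f j := by
      intro i j hij
      obtain ⟨k, hk⟩ := hij.exists_nat_pow_eq
      rw [← hk]
      clear hk
      induction k with
      | zero => simp
      | succ k ih => rw [pow_succ', Perm.mul_apply, hf, ← ih]
    refine ⟨fun k => f (Function.surjInv (kap_surj g) k), ?_⟩
    apply Subtype.ext
    funext i
    apply hz
    apply kap_same
    exact Function.surjInv_eq (kap_surj g) _
end fc

lemma poly_identity (n : ℕ) :
    ∑ s : Perm (Fin n), ∑ t : Perm (Fin n), (Polynomial.X : Polynomial ℚ) ^ numCycles (s * t * s⁻¹ * t⁻¹) =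
      Polynomial.C (n.factorial : ℚ) * ∑ S ∈ LS n, cpoly S := by
  apply Polynomial.eq_of_infinite_eval_eq
  refine ((good_N n).image (f := fun N : ℕ => (N : ℚ)) Nat.cast_injective.injOn).mono ?_
  rintro _ ⟨N, hN, rfl⟩
  have := main_eval n N hN
  simp only [fixCnt_eq] at this
  simp only [Set.mem_setOf_eq, Polynomial.eval_finsetSum, Polynomial.eval_pow, Polynomial.eval_X, Polynomial.eval_mul, Polynomial.eval_C]
  push_cast at this
  exact this

lemma cycProb_eq (n ℓ : ℕ) : cycProb n ℓ = (((∑ S ∈ LS n, (cpoly S).coeff ℓ : ℚ)) : ℝ) / (n.factorial : ℝ) := by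
  have h := congrArg (fun p => p.coeff ℓ) (poly_identity n)
  simp only [Polynomial.finsetSum_coeff, Polynomial.coeff_X_pow, Polynomial.coeff_C_mul] at h
  have h2 : (Nat.card {p : Perm (Fin n) × Perm (Fin n) //
      numCycles (p.1 * p.2 * p.1⁻¹ * p.2⁻¹) = ℓ} : ℚ) = (n.factorial : ℚ) * ∑ S ∈ LS n, (cpoly S).coeff ℓ := by
    rw [← h, ← Fintype.sum_prod_type', Nat.card_eq_fintype_card, Fintype.card_subtype, Finset.card_filter]
    push_cast
    refine Finset.sum_congr rfl fun p _ => ?_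
    simp [eq_comm]
  have h3 := congrArg (fun q : ℚ => (q : ℝ)) h2
  rw [Rat.cast_natCast, Rat.cast_mul, Rat.cast_natCast] at h3
  unfold cycProb
  rw [h3]
  have : (n.factorial : ℝ) ≠ 0 := by exact_mod_cast n.factorial_ne_zero
  field_simp

open Equiv

def wt (S : Finset (ℕ × ℕ)) : ℕ := ∏ x ∈ S, (1 + ((x.1 - x.2) + (x.2 - x.1)))

lemma lowerN (T : Finset ℕ) (h : ∀ i j, i ≤ j → j ∈ T → i ∈ T) : T = Finset.range T.card := by
  apply Finset.eq_of_subset_of_card_le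
  · intro j hj
    have : Finset.range (j+1) ⊆ T := fun i hi => h i j (by simp at hi; omega) hj
    have := Finset.card_le_card this
    simp at this ⊢; omega
  · simp

def hA (S : Finset (ℕ × ℕ)) : ℕ := ((S.filter (fun x => x.1 = 0)).image Prod.snd).card
def hB (S : Finset (ℕ × ℕ)) : ℕ := ((S.filter (fun x => x.2 = 0)).image Prod.fst).card
def inn (S : Finset (ℕ × ℕ)) : Finset (ℕ × ℕ) :=
  (S.filter (fun x => x.1 ≠ 0 ∧ x.2 ≠ 0)).image (fun x => (x.1 - 1, x.2 - 1))

section hook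
variable {S : Finset (ℕ × ℕ)} (h : IsLowerSet (S : Set (ℕ × ℕ)))
include h

lemma mem_hA (j : ℕ) : (0, j) ∈ S ↔ j < hA S := by
  have h1 := lowerN ((S.filter (fun x => x.1 = 0)).image Prod.snd) (by
    intro i j hij hj
    simp at hj ⊢
    exact h (show (0, i) ≤ (0, j) from ⟨le_refl _, hij⟩) hj)
  have h2 : j ∈ ((S.filter (fun x => x.1 = 0)).image Prod.snd) ↔ (0, j) ∈ S := by simp
  rw [← h2, h1, Finset.mem_range]; rfl

lemma mem_hB (j : ℕ) : (j, 0) ∈ S ↔ j < hB S := by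
  have h1 := lowerN ((S.filter (fun x => x.2 = 0)).image Prod.fst) (by
    intro i j hij hj
    simp at hj ⊢
    exact h (show (i, 0) ≤ (j, 0) from ⟨hij, le_refl _⟩) hj)
  have h2 : j ∈ ((S.filter (fun x => x.2 = 0)).image Prod.fst) ↔ (j, 0) ∈ S := by simp
  rw [← h2, h1, Finset.mem_range]; rfl

lemma mem_inn (i j : ℕ) : (i, j) ∈ inn S ↔ (i+1, j+1) ∈ S := by
  unfold inn
  simp only [Finset.mem_image, Finset.mem_filter]
  constructor
  · rintro ⟨⟨a, b⟩, ⟨h1, h2, h3⟩, h4⟩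
    simp at h2 h3 h4
    have e1 : a = i + 1 := by omega
    have e2 : b = j + 1 := by omega
    rw [← e1, ← e2]; exact h1
  · intro h1
    exact ⟨(i+1, j+1), ⟨h1, by simp⟩, by simp⟩

lemma inn_lower : IsLowerSet (inn S : Set (ℕ × ℕ)) := by
  rintro ⟨a, b⟩ ⟨c, d⟩ hle hm
  rw [Finset.mem_coe, mem_inn h] at hm ⊢
  exact h (show (c+1, d+1) ≤ (a+1, b+1) from ⟨Nat.succ_le_succ hle.1, Nat.succ_le_succ hle.2⟩) hm

lemma hook_decomp : S = ((Finset.range (hA S)).image (fun j => (0, j)) ∪ (Finset.Ico 1 (hB S)).image (fun i => (i, 0)))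
    ∪ (inn S).image (fun x => (x.1 + 1, x.2 + 1)) := by
  ext ⟨i, j⟩
  simp only [Finset.mem_union, Finset.mem_image, Finset.mem_range, Finset.mem_Ico, Prod.mk.injEq, Prod.exists]
  rcases i with _ | i
  · rw [mem_hA h]; simp
  · rcases j with _ | j
    · rw [mem_hB h]; simp
    · rw [← mem_inn h]; simp

lemma hook_prod {M : Type*} [CommMonoid M] (f : ℕ × ℕ → M) : ∏ x ∈ S, f x =
    (∏ j ∈ Finset.range (hA S), f (0, j)) * (∏ i ∈ Finset.Ico 1 (hB S), f (i, 0)) * ∏ x ∈ inn S, f (x.1+1, x.2+1) := by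
  conv_lhs => rw [hook_decomp h]
  rw [Finset.prod_union, Finset.prod_union, Finset.prod_image, Finset.prod_image, Finset.prod_image]
  · rintro ⟨a, b⟩ _ ⟨c, d⟩ _ hh; simpa using hh
  · intro a _ b _ hh; simpa using hh
  · intro a _ b _ hh; simpa using hh
  · rw [Finset.disjoint_left]; intro x hx hy
    simp at hx hy
    obtain ⟨a, _, rfl⟩ := hx
    obtain ⟨b, hb, hc⟩ := hy
    simp at hc; omega
  · rw [Finset.disjoint_left]; intro x hx hy
    simp at hx hy
    obtain ⟨c, d, _, rfl⟩ := hy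
    rcases hx with ⟨a, _, hx⟩ | ⟨a, _, hx⟩ <;> simp at hx

lemma hook_wt : wt S = (hA S).factorial * (hB S).factorial * wt (inn S) := by
  unfold wt
  rw [hook_prod h]
  congr 1
  · congr 1
    · rw [← Finset.prod_range_add_one_eq_factorial]
      refine Finset.prod_congr rfl fun j _ => by omega
    · rcases Nat.eq_zero_or_pos (hB S) with h0 | h0
      · simp [h0]
      · rw [← Finset.prod_range_add_one_eq_factorial]
        rw [Finset.range_eq_Ico, Finset.prod_eq_prod_Ico_succ_bot h0]
        simp
        refine Finset.prod_congr rfl fun j _ => by omega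
  · refine Finset.prod_congr rfl fun x _ => by omega

lemma hook_card (hne : S.Nonempty) : 1 ≤ hA S ∧ 1 ≤ hB S ∧ S.card + 1 = hA S + hB S + (inn S).card := by
  obtain ⟨x, hx⟩ := hne
  have h0 : ((0, 0) : ℕ × ℕ) ∈ S := h (show (0, 0) ≤ x from ⟨Nat.zero_le _, Nat.zero_le _⟩) hx
  have h1 := (mem_hA h 0).mp h0
  have h2 := (mem_hB h 0).mp h0
  refine ⟨h1, h2, ?_⟩
  have := hook_prod h (M := Multiplicative ℕ) (fun _ => Multiplicative.ofAdd 1)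
  have h3 := congrArg Multiplicative.toAdd this
  simp at h3
  omega

end hook

lemma hook_inj {S T : Finset (ℕ × ℕ)} (hS : IsLowerSet (S : Set (ℕ × ℕ))) (hT : IsLowerSet (T : Set (ℕ × ℕ)))
    (h1 : hA S = hA T) (h2 : hB S = hB T) (h3 : inn S = inn T) : S = T := by
  rw [hook_decomp hS, hook_decomp hT, h1, h2, h3]

noncomputable def sw (n : ℕ) : ℕ := ∑ S ∈ LS n, wt S

lemma sw_zero : sw 0 = 1 := by
  have : LS 0 = {∅} := by
    ext S
    rw [mem_LS, Finset.card_eq_zero, Finset.mem_singleton]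
    constructor
    · exact fun h => h.1
    · rintro rfl; exact ⟨rfl, by simp [IsLowerSet]⟩
  unfold sw
  rw [this]; simp [wt]

lemma fiber_bound (n : ℕ) (hn : 1 ≤ n) (U : Finset (Finset (ℕ × ℕ))) (hU : U ⊆ LS n) (m a : ℕ) :
    ∑ S ∈ (U.filter (fun S => hA S + hB S = m)).filter (fun S => hA S = a), wt S ≤
      a.factorial * (m - a).factorial * sw (n + 1 - m) := by
  have hmem : ∀ S ∈ (U.filter (fun S => hA S + hB S = m)).filter (fun S => hA S = a), 
      IsLowerSet (S : Set (ℕ × ℕ)) ∧ hA S = a ∧ hB S = m - a ∧ inn S ∈ LS (n + 1 - m) := by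
    intro S hS
    simp only [Finset.mem_filter] at hS
    obtain ⟨⟨h1, h2⟩, h3⟩ := hS
    have h4 := mem_LS.mp (hU h1)
    have h5 := hook_card h4.2 (Finset.card_pos.mp (by omega))
    refine ⟨h4.2, h3, by omega, ?_⟩
    rw [mem_LS]
    exact ⟨by omega, inn_lower h4.2⟩
  rw [Finset.sum_congr rfl (g := fun S => a.factorial * (m - a).factorial * wt (inn S))]
  · rw [← Finset.mul_sum]
    refine Nat.mul_le_mul_left _ ?_
    rw [← Finset.sum_image (f := wt) (g := inn)]
    · refine Finset.sum_le_sum_of_subset ?_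
      intro T hT
      obtain ⟨S, hS, rfl⟩ := Finset.mem_image.mp hT
      exact (hmem S hS).2.2.2
    · intro S hS T hT hST
      obtain ⟨s1, s2, s3, _⟩ := hmem S hS
      obtain ⟨t1, t2, t3, _⟩ := hmem T hT
      exact hook_inj s1 t1 (by rw [s2, t2]) (by rw [s3, t3]) hST
  · intro S hS
    obtain ⟨s1, s2, s3, _⟩ := hmem S hS
    rw [hook_wt s1, s2, s3]

lemma fact_le (k b a : ℕ) (hka : k ≤ a) (hkb : k ≤ b) : a.factorial * b.factorial ≤ k.factorial * (a + b - k).factorial := by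
  induction a, hka using Nat.le_induction with
  | base => rw [Nat.add_sub_cancel_left]
  | succ a ha ih =>
    have e : a + 1 + b - k = (a + b - k) + 1 := by omega
    rw [e, Nat.factorial_succ, Nat.factorial_succ]
    calc (a+1) * a.factorial * b.factorial = (a+1) * (a.factorial * b.factorial) := by ring
      _ ≤ (a + b - k + 1) * (k.factorial * (a + b - k).factorial) := Nat.mul_le_mul (by omega) ih
      _ = _ := by ring

lemma fsum1 (m : ℕ) (hm : 2 ≤ m) : ∑ a ∈ Finset.Icc 1 (m-1), a.factorial * (m - a).factorial ≤ 4 * (m-1).factorial := by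
  obtain ⟨k, rfl⟩ : ∃ k, m = k + 2 := ⟨m - 2, by omega⟩
  have hb : ∀ a ∈ Finset.Icc 1 (k+2-1), a.factorial * (k + 2 - a).factorial ≤
      ((if a = 1 then (k+1).factorial else 0) + (if a = k + 1 then (k+1).factorial else 0)) + 2 * k.factorial := by
    intro a ha
    rw [Finset.mem_Icc] at ha
    by_cases h1 : a = 1
    · subst h1; simp; omega
    by_cases h2 : a = k + 1
    · subst h2
      have : k + 2 - (k + 1) = 1 := by omega
      rw [this]; simp; omega
    have := fact_le 2 (k+2-a) a (by omega) (by omega)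
    have e : a + (k + 2 - a) - 2 = k := by omega
    rw [e] at this
    simp [h1, h2]
    simpa using this
  refine (Finset.sum_le_sum hb).trans ?_
  rw [Finset.sum_add_distrib, Finset.sum_add_distrib, Finset.sum_ite_eq', Finset.sum_ite_eq', Finset.sum_const]
  have : k + 2 - 1 = k + 1 := by omega
  rw [this]
  simp only [Nat.card_Icc, smul_eq_mul, Nat.add_sub_cancel]
  rw [if_pos (by simp), if_pos (by simp), Nat.factorial_succ]
  nlinarith [Nat.factorial_pos k]

lemma fsum2 (n : ℕ) (hn : 2 ≤ n) : ∑ a ∈ Finset.Icc 2 (n-1), a.factorial * (n + 1 - a).factorial ≤ 10 * (n-1).factorial := by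
  obtain ⟨k, rfl⟩ : ∃ k, n = k + 2 := ⟨n - 2, by omega⟩
  have hb : ∀ a ∈ Finset.Icc 2 (k+2-1), a.factorial * (k + 2 + 1 - a).factorial ≤
      ((if a = 2 then 2 * (k+1).factorial else 0) + (if a = k + 1 then 2 * (k+1).factorial else 0)) + 6 * k.factorial := by
    intro a ha
    rw [Finset.mem_Icc] at ha
    by_cases h1 : a = 2
    · subst h1; simp; omega
    by_cases h2 : a = k + 1
    · subst h2
      have : k + 2 + 1 - (k + 1) = 2 := by omega
      rw [this]; simp; omega
    have := fact_le 3 (k+2+1-a) a (by omega) (by omega)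
    have e : a + (k + 2 + 1 - a) - 3 = k := by omega
    rw [e] at this
    simp [h1, h2]
    have h36 : Nat.factorial 3 = 6 := rfl
    rw [h36] at this
    exact this
  refine (Finset.sum_le_sum hb).trans ?_
  rw [Finset.sum_add_distrib, Finset.sum_add_distrib, Finset.sum_ite_eq', Finset.sum_ite_eq', Finset.sum_const]
  have : k + 2 - 1 = k + 1 := by omega
  rw [this]
  simp only [Nat.card_Icc, smul_eq_mul]
  have h3 : k + 1 + 1 - 2 = k := by omega
  rw [h3]
  have h4 : (k+1).factorial = (k+1) * k.factorial := Nat.factorial_succ k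
  have h5 := Nat.factorial_pos k
  split_ifs <;> nlinarith

lemma m_bound (n : ℕ) (hn : 1 ≤ n) (U : Finset (Finset (ℕ × ℕ))) (hU : U ⊆ LS n) (m : ℕ) (hm : 2 ≤ m) :
    ∑ S ∈ U.filter (fun S => hA S + hB S = m), wt S ≤ 4 * (m-1).factorial * sw (n + 1 - m) := by
  rw [← Finset.sum_fiberwise_of_maps_to (t := Finset.Icc 1 (m-1)) (g := hA)]
  · refine (Finset.sum_le_sum fun a _ => fiber_bound n hn U hU m a).trans ?_
    rw [← Finset.sum_mul]
    exact Nat.mul_le_mul_right _ (fsum1 m hm)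
  · intro S hS
    rw [Finset.mem_filter] at hS
    have h4 := mem_LS.mp (hU hS.1)
    have h5 := hook_card h4.2 (Finset.card_pos.mp (by omega))
    rw [Finset.mem_Icc]; omega

lemma U_split (n : ℕ) (hn : 1 ≤ n) (U : Finset (Finset (ℕ × ℕ))) (hU : U ⊆ LS n) :
    ∑ S ∈ U, wt S ≤ ∑ S ∈ U.filter (fun S => hA S + hB S = n + 1), wt S + 
      ∑ m ∈ Finset.Icc 2 n, 4 * (m-1).factorial * sw (n + 1 - m) := by
  rw [← Finset.sum_fiberwise_of_maps_to (t := Finset.Icc 2 (n+1)) (g := fun S => hA S + hB S)]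
  · rw [Finset.sum_Icc_succ_top (by omega), add_comm]
    refine Nat.add_le_add_left ?_ _
    refine Finset.sum_le_sum fun m hm => m_bound n hn U hU m (Finset.mem_Icc.mp hm).1
  · intro S hS
    have h4 := mem_LS.mp (hU hS)
    have h5 := hook_card h4.2 (Finset.card_pos.mp (by omega))
    rw [Finset.mem_Icc]; omega

lemma tail_bound (n K : ℕ) (hn : 2 ≤ n) (hK : ∀ k < n, sw k ≤ K * k.factorial) :
    ∑ m ∈ Finset.Icc 2 n, 4 * (m-1).factorial * sw (n + 1 - m) ≤ 16 * K * (n-1).factorial := by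
  have h1 : ∑ m ∈ Finset.Icc 2 n, 4 * (m-1).factorial * sw (n + 1 - m) ≤
      ∑ m ∈ Finset.Icc 2 n, 4 * K * ((m-1).factorial * (n + 1 - m).factorial) := by
    refine Finset.sum_le_sum fun m hm => ?_
    rw [Finset.mem_Icc] at hm
    have := hK (n + 1 - m) (by omega)
    calc _ ≤ 4 * (m-1).factorial * (K * (n+1-m).factorial) := Nat.mul_le_mul_left _ this
      _ = _ := by ring
  refine h1.trans ?_
  rw [← Finset.mul_sum]
  have h2 : ∑ m ∈ Finset.Icc 2 n, ((m-1).factorial * (n + 1 - m).factorial) = ∑ a ∈ Finset.Icc 1 (n-1), a.factorial * (n - a).factorial := by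
    refine Finset.sum_nbij' (fun m => m - 1) (fun a => a + 1) ?_ ?_ ?_ ?_ ?_
    · intro m hm; simp at hm ⊢; omega
    · intro m hm; simp at hm ⊢; omega
    · intro m hm; simp at hm ⊢; omega
    · intro m hm; simp
    · intro m hm
      simp at hm
      have : n + 1 - m = n - (m - 1) := by omega
      rw [this]
  rw [h2]
  calc _ ≤ 4 * K * (4 * (n-1).factorial) := Nat.mul_le_mul_left _ (fsum1 n hn)
    _ = _ := by ring

lemma sw_bound : ∃ K : ℕ, ∀ n, sw n ≤ K * n.factorial := by
  obtain ⟨K, hK8, hKs⟩ : ∃ K : ℕ, 8 ≤ K ∧ ∀ n < 32, sw n ≤ K := by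
    refine ⟨8 + ∑ i ∈ Finset.range 32, sw i, Nat.le_add_right _ _, fun n hn => ?_⟩
    exact (Finset.single_le_sum (f := sw) (fun i _ => Nat.zero_le _) (Finset.mem_range.mpr hn)).trans (Nat.le_add_left _ _)
  refine ⟨K, ?_⟩
  intro n
  induction n using Nat.strong_induction_on with
  | _ n ih =>
    by_cases hn : n < 32
    · have h1 : sw n ≤ K := hKs n hn
      exact h1.trans (Nat.le_mul_of_pos_right _ n.factorial_pos)
    · have h1 := U_split n (by omega) (LS n) (le_refl _)
      have h2 := tail_bound n K (by omega) ih
      have h3 := m_bound n (by omega) (LS n) (le_refl _) (n+1) (by omega)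
      have e1 : n + 1 - (n + 1) = 0 := by omega
      rw [e1, sw_zero] at h3
      have e2 : n + 1 - 1 = n := by omega
      rw [e2] at h3
      have hf : n.factorial = n * (n-1).factorial := (Nat.mul_factorial_pred (by omega)).symm
      have hsum : sw n ≤ 4 * n.factorial + 16 * K * (n-1).factorial := by
        have e3 : sw n = ∑ S ∈ LS n, wt S := rfl
        rw [e3]
        refine h1.trans ?_
        rw [mul_one] at h3
        exact Nat.add_le_add h3 h2
      refine hsum.trans ?_
      rw [hf]
      have : 4 * n + 16 * K ≤ K * n := by nlinarith
      calc _ = (4 * n + 16 * K) * (n-1).factorial := by ring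
        _ ≤ K * n * (n-1).factorial := Nat.mul_le_mul_right _ this
        _ = _ := by ring

def rowS (n : ℕ) : Finset (ℕ × ℕ) := (Finset.range n).image (fun j => (0, j))
def colS (n : ℕ) : Finset (ℕ × ℕ) := (Finset.range n).image (fun j => (j, 0))

lemma rest_bound : ∃ K : ℕ, ∀ n, 2 ≤ n → ∑ S ∈ (LS n).filter (fun S => S ≠ rowS n ∧ S ≠ colS n), wt S ≤ K * (n-1).factorial := by
  obtain ⟨K, hK⟩ := sw_bound
  refine ⟨10 + 16 * K, fun n hn => ?_⟩
  set U := (LS n).filter (fun S => S ≠ rowS n ∧ S ≠ colS n)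
  have hU : U ⊆ LS n := Finset.filter_subset _ _
  have h1 := U_split n (by omega) U hU
  have h2 := tail_bound n K hn (fun k _ => hK k)
  have h3 : ∑ S ∈ U.filter (fun S => hA S + hB S = n + 1), wt S ≤ 10 * (n-1).factorial := by
    rw [← Finset.sum_fiberwise_of_maps_to (t := Finset.Icc 2 (n-1)) (g := hA)]
    · refine (Finset.sum_le_sum fun a _ => fiber_bound n (by omega) U hU (n+1) a).trans ?_
      rw [Nat.sub_self, sw_zero]
      simp only [mul_one]
      exact fsum2 n hn
    · intro S hS
      rw [Finset.mem_filter, Finset.mem_filter] at hS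
      obtain ⟨⟨hS1, hS2, hS3⟩, hS4⟩ := hS
      have h4 := mem_LS.mp hS1
      have h5 := hook_card h4.2 (Finset.card_pos.mp (by omega))
      have hin : inn S = ∅ := by rw [← Finset.card_eq_zero]; omega
      have hd := hook_decomp h4.2
      rw [hin, Finset.image_empty, Finset.union_empty] at hd
      have ha1 : hA S ≠ 1 := by
        intro ha
        apply hS3
        have hb : hB S = n := by omega
        rw [hd, ha, hb]
        ext ⟨i, j⟩
        simp [colS]
        constructor
        · rintro (⟨rfl, rfl⟩ | ⟨h1, rfl⟩) <;> omega
        · rintro ⟨h1, rfl⟩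
          rcases Nat.eq_zero_or_pos i with rfl | hi
          · simp
          · right; omega
      have hb1 : hB S ≠ 1 := by
        intro hb
        apply hS2
        have ha : hA S = n := by omega
        rw [hd, ha, hb]
        simp [rowS]
      rw [Finset.mem_Icc]; omega
  calc _ ≤ 10 * (n-1).factorial + 16 * K * (n-1).factorial := by linarith
    _ = _ := by ring

open Equiv

noncomputable def stq (n : ℕ) : Polynomial ℚ := ∏ k ∈ Finset.range n, (Polynomial.X + Polynomial.C (k : ℚ))

lemma cpoly_row (n : ℕ) : cpoly (rowS n) = stq n := by
  unfold cpoly rowS stq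
  rw [Finset.prod_image (fun a _ b _ h => by simpa using h)]
  simp

lemma cpoly_col_coeff (n ℓ : ℕ) : (cpoly (colS n)).coeff ℓ = (-1) ^ (n + ℓ) * (stq n).coeff ℓ := by
  unfold cpoly colS stq
  rw [Finset.prod_image (fun a _ b _ h => by simpa using h)]
  induction n generalizing ℓ with
  | zero =>
    rcases ℓ with _ | ℓ
    · simp
    · simp [Polynomial.coeff_one]
  | succ n ih =>
    rw [Finset.prod_range_succ, Finset.prod_range_succ, mul_add, mul_add, Polynomial.coeff_add, Polynomial.coeff_add,
      Polynomial.coeff_mul_C, Polynomial.coeff_mul_C, ih]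
    rcases ℓ with _ | ℓ
    · simp; ring
    · rw [Polynomial.coeff_mul_X, Polynomial.coeff_mul_X, ih]
      simp; ring

lemma cpoly_coeff_le (S : Finset (ℕ × ℕ)) (ℓ : ℕ) : |(cpoly S).coeff ℓ| ≤ (wt S : ℚ) := by
  classical
  unfold cpoly wt
  induction S using Finset.induction generalizing ℓ with
  | empty => 
    simp only [Finset.prod_empty, Polynomial.coeff_one]
    split_ifs <;> simp
  | insert x S hx ih =>
    rw [Finset.prod_insert hx, Finset.prod_insert hx, add_mul, Polynomial.coeff_add, Polynomial.coeff_C_mul]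
    have h1 : |(Polynomial.X * ∏ x ∈ S, (Polynomial.X + Polynomial.C ((x.2 : ℚ) - x.1))).coeff ℓ| ≤
        ((∏ x ∈ S, (1 + ((x.1 - x.2) + (x.2 - x.1))) : ℕ) : ℚ) := by
      rcases ℓ with _ | ℓ
      · simp only [Polynomial.coeff_X_mul_zero, abs_zero]
        positivity
      · rw [Polynomial.coeff_X_mul]; exact ih ℓ
    have h2 := ih ℓ
    have h3 : |((x.2 : ℚ) - x.1)| = (((x.1 - x.2) + (x.2 - x.1) : ℕ) : ℚ) := by
      rcases le_total x.1 x.2 with h | h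
      · rw [Nat.sub_eq_zero_of_le h, zero_add, Nat.cast_sub h, abs_of_nonneg]
        rw [sub_nonneg]; exact_mod_cast h
      · rw [Nat.sub_eq_zero_of_le h, add_zero, Nat.cast_sub h, abs_of_nonpos, neg_sub]
        rw [sub_nonpos]; exact_mod_cast h
    refine (abs_add_le _ _).trans ?_
    rw [abs_mul, h3, Nat.cast_mul, Nat.cast_add 1, Nat.cast_one, add_mul, one_mul]
    exact add_le_add h1 (mul_le_mul_of_nonneg_left h2 (Nat.cast_nonneg _))

lemma row_mem (n : ℕ) : rowS n ∈ LS n := by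
  rw [mem_LS]
  constructor
  · unfold rowS; rw [Finset.card_image_of_injective _ (fun a b h => by simpa using h), Finset.card_range]
  · rintro ⟨a, b⟩ ⟨c, d⟩ ⟨h1, h2⟩ h
    simp [rowS] at *
    omega

lemma col_mem (n : ℕ) : colS n ∈ LS n := by
  rw [mem_LS]
  constructor
  · unfold colS; rw [Finset.card_image_of_injective _ (fun a b h => by simpa using h), Finset.card_range]
  · rintro ⟨a, b⟩ ⟨c, d⟩ ⟨h1, h2⟩ h
    simp [colS] at *
    omega

noncomputable def pl (n ℓ : ℕ) : ℝ := (((stq n).coeff ℓ : ℚ) : ℝ) / n.factorial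

lemma cycProb_approx : ∃ K : ℝ, 0 ≤ K ∧ ∀ n : ℕ, n ≥ 2 → ∀ ℓ : ℕ, Even ((n : ℤ) - (ℓ : ℤ)) →
    |cycProb n ℓ - 2 * pl n ℓ| ≤ K / n := by
  obtain ⟨K, hK⟩ := rest_bound
  refine ⟨K, Nat.cast_nonneg _, fun n hn ℓ hev => ?_⟩
  have hne : rowS n ≠ colS n := by
    intro h
    have : (0, 1) ∈ colS n := by rw [← h]; simp [rowS]; omega
    simp [colS] at this
  have hsplit : ∑ S ∈ LS n, (cpoly S).coeff ℓ = 2 * (stq n).coeff ℓ + 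
      ∑ S ∈ (LS n).filter (fun S => S ≠ rowS n ∧ S ≠ colS n), (cpoly S).coeff ℓ := by
    have e : (LS n).filter (fun S => S ≠ rowS n ∧ S ≠ colS n) = ((LS n).erase (rowS n)).erase (colS n) := by
      ext S; simp only [Finset.mem_filter, Finset.mem_erase]; tauto
    rw [e, ← Finset.add_sum_erase _ _ (row_mem n), 
      ← Finset.add_sum_erase _ _ (Finset.mem_erase.mpr ⟨hne.symm, col_mem n⟩), cpoly_row, cpoly_col_coeff]
    have : (-1 : ℚ) ^ (n + ℓ) = 1 := by
      apply Even.neg_one_pow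
      rw [Int.even_sub] at hev
      rw [Nat.even_add]
      exact_mod_cast hev
    rw [this]; ring
  have hb : |∑ S ∈ (LS n).filter (fun S => S ≠ rowS n ∧ S ≠ colS n), (cpoly S).coeff ℓ| ≤ ((K * (n-1).factorial : ℕ) : ℚ) := by
    refine (Finset.abs_sum_le_sum_abs _ _).trans ?_
    refine (Finset.sum_le_sum fun S _ => cpoly_coeff_le S ℓ).trans ?_
    rw [← Nat.cast_sum]
    exact_mod_cast hK n hn
  have hf : (n.factorial : ℝ) = n * (n-1).factorial := by
    exact_mod_cast (Nat.mul_factorial_pred (by omega : n ≠ 0)).symm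
  have hf0 : (0:ℝ) < (n-1).factorial := by exact_mod_cast Nat.factorial_pos _
  have hn0 : (0:ℝ) < n := by exact_mod_cast (by omega : 0 < n)
  rw [cycProb_eq, hsplit]
  unfold pl
  have hb' : |((∑ S ∈ (LS n).filter (fun S => S ≠ rowS n ∧ S ≠ colS n), (cpoly S).coeff ℓ : ℚ) : ℝ)| ≤ K * (n-1).factorial := by
    exact_mod_cast hb
  generalize ∑ S ∈ (LS n).filter (fun S => S ≠ rowS n ∧ S ≠ colS n), (cpoly S).coeff ℓ = y at hb'
  push_cast
  have : (2 * ((stq n).coeff ℓ : ℝ) + (y : ℝ)) / (n.factorial : ℝ) - 2 * (((stq n).coeff ℓ : ℝ) / n.factorial) = y / n.factorial := by ring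
  rw [this, abs_div, hf, abs_of_pos (mul_pos hn0 hf0), div_le_div_iff₀ (mul_pos hn0 hf0) hn0]
  calc _ ≤ K * ((n-1).factorial : ℝ) * n := mul_le_mul_of_nonneg_right hb' hn0.le
    _ = _ := by ring

open Equiv

noncomputable def phi (n : ℕ) (t : ℝ) : ℂ := ∏ k ∈ Finset.Icc 1 n, (1 + (Complex.exp (t * Complex.I) - 1) / (k : ℂ))

lemma phi_eq (n : ℕ) (t : ℝ) : phi n t = ∑ m ∈ Finset.range ((stq n).natDegree + 1), (pl n m : ℂ) * Complex.exp (m * t * Complex.I) := by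
  have h1 : Polynomial.aeval (Complex.exp (t * Complex.I)) (stq n) = phi n t * (n.factorial : ℂ) := by
    unfold stq phi
    rw [map_prod, ← Finset.prod_range_add_one_eq_factorial, Nat.cast_prod,
      Finset.range_eq_Ico]
    have : Finset.Icc 1 n = Finset.Ico (0+1) (n+1) := by ext; simp
    rw [this, ← Finset.prod_Ico_add' _ 0 n 1, ← Finset.prod_mul_distrib]
    refine Finset.prod_congr rfl fun k _ => ?_
    have hk : ((k : ℂ) + 1) ≠ 0 := by exact_mod_cast Nat.succ_ne_zero k
    simp
    field_simp
    ring
  have hf : (n.factorial : ℂ) ≠ 0 := by exact_mod_cast n.factorial_ne_zero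
  rw [Polynomial.aeval_eq_sum_range] at h1
  rw [← mul_left_inj' hf, ← h1, Finset.sum_mul]
  refine Finset.sum_congr rfl fun m _ => ?_
  unfold pl
  rw [← Complex.exp_nat_mul, Algebra.smul_def]
  push_cast
  rw [mul_assoc (m : ℂ)]
  field_simp
  rfl

lemma int_exp (k : ℤ) : ∫ t in (-Real.pi)..Real.pi, Complex.exp (k * t * Complex.I) = if k = 0 then (2 * Real.pi : ℂ) else 0 := by
  split_ifs with h
  · subst h; simp; ring
  · have hk : (k : ℂ) * Complex.I ≠ 0 := by simp [h]
    have := integral_exp_mul_complex (a := -Real.pi) (b := Real.pi) hk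
    have e : ∀ t : ℝ, Complex.exp (k * t * Complex.I) = Complex.exp (k * Complex.I * t) := fun t => by ring_nf
    simp only [e]
    rw [this, div_eq_zero_iff]
    left
    rw [sub_eq_zero, Complex.exp_eq_exp_iff_exists_int]
    refine ⟨k, ?_⟩
    push_cast; ring

lemma pl_integral (n ℓ : ℕ) : ∫ t in (-Real.pi)..Real.pi, phi n t * Complex.exp (-(ℓ * t * Complex.I)) = 2 * Real.pi * (pl n ℓ : ℂ) := by
  simp only [phi_eq, Finset.sum_mul]
  rw [intervalIntegral.integral_finsetSum]
  · have e : ∀ m : ℕ, ∀ t : ℝ, (pl n m : ℂ) * Complex.exp (m * t * Complex.I) * Complex.exp (-(ℓ * t * Complex.I)) = 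
      (pl n m : ℂ) * Complex.exp ((((m : ℤ) - (ℓ : ℤ) : ℤ) : ℂ) * t * Complex.I) := by
      intro m t
      rw [mul_assoc, ← Complex.exp_add]
      congr 2
      push_cast; ring
    simp only [e, intervalIntegral.integral_const_mul, int_exp]
    have e2 : ∀ m : ℕ, ((m : ℤ) - ℓ = 0) ↔ m = ℓ := fun m => by omega
    simp only [e2, mul_ite, mul_zero]
    rw [Finset.sum_ite_eq']
    split_ifs with h
    · ring
    · have : pl n ℓ = 0 := by
        unfold pl
        rw [Polynomial.coeff_eq_zero_of_natDegree_lt]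
        · simp
        · simp at h; omega
      simp [this]
  · intro m _
    apply Continuous.intervalIntegrable
    fun_prop

lemma prod_diff {ι : Type*} [DecidableEq ι] (s : Finset ι) (f g : ι → ℂ) (e d : ι → ℝ) (he : ∀ k ∈ s, ‖f k‖ ≤ e k ∧ ‖g k‖ ≤ e k)
    (hd : ∀ k ∈ s, ‖f k - g k‖ ≤ d k * e k) :
    ‖∏ k ∈ s, f k‖ ≤ ∏ k ∈ s, e k ∧ ‖∏ k ∈ s, f k - ∏ k ∈ s, g k‖ ≤ (∑ k ∈ s, d k) * ∏ k ∈ s, e k := by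
  induction s using Finset.induction with
  | empty => simp
  | insert a s ha ih =>
    obtain ⟨i1, i2⟩ := ih (fun k hk => he k (Finset.mem_insert_of_mem hk)) (fun k hk => hd k (Finset.mem_insert_of_mem hk))
    obtain ⟨a1, a2⟩ := he a (Finset.mem_insert_self a s)
    have a3 := hd a (Finset.mem_insert_self a s)
    rw [Finset.prod_insert ha, Finset.prod_insert ha, Finset.prod_insert ha, Finset.sum_insert ha]
    have hea : 0 ≤ e a := (norm_nonneg _).trans a1
    constructor
    · rw [norm_mul]; exact mul_le_mul a1 i1 (norm_nonneg _) hea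
    · have : f a * ∏ k ∈ s, f k - g a * ∏ k ∈ s, g k = (f a - g a) * ∏ k ∈ s, f k + g a * (∏ k ∈ s, f k - ∏ k ∈ s, g k) := by ring
      rw [this]
      refine (norm_add_le _ _).trans ?_
      rw [norm_mul, norm_mul]
      calc _ ≤ d a * e a * ∏ k ∈ s, e k + e a * ((∑ k ∈ s, d k) * ∏ k ∈ s, e k) :=
            add_le_add (mul_le_mul a3 i1 (norm_nonneg _) ((norm_nonneg _).trans a3)) (mul_le_mul a2 i2 (norm_nonneg _) hea)
        _ = _ := by ring

noncomputable def fk (u t : ℝ) : ℂ := (1 + u * (Complex.exp (t * Complex.I) - 1)) * Complex.exp (-(u * t * Complex.I))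
noncomputable def gk (u t : ℝ) : ℂ := ((Real.exp (-((u - u^2) * t^2 / 2)) : ℝ) : ℂ)

lemma fk_norm (u t : ℝ) (h0 : 0 ≤ u) (h1 : u ≤ 1) (ht : |t| ≤ Real.pi) :
    ‖fk u t‖ ≤ Real.exp (-(2 / Real.pi^2 * (u - u^2) * t^2)) := by
  have hv : 0 ≤ u - u^2 := by nlinarith
  have hn : ‖fk u t‖ = ‖(1 + u * (Complex.exp (t * Complex.I) - 1))‖ := by
    unfold fk
    rw [norm_mul]
    have : -((u : ℂ) * t * Complex.I) = ((-(u*t) : ℝ) : ℂ) * Complex.I := by push_cast; ring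
    rw [this, Complex.norm_exp_ofReal_mul_I, mul_one]
  have hsq : ‖fk u t‖^2 = 1 - 2 * (u - u^2) * (1 - Real.cos t) := by
    rw [hn, Complex.sq_norm, Complex.normSq_apply]
    have hr : (1 + (u:ℂ) * (Complex.exp (t * Complex.I) - 1)).re = 1 + u * (Real.cos t - 1) := by
      simp [Complex.exp_ofReal_mul_I_re]
    have hi : (1 + (u:ℂ) * (Complex.exp (t * Complex.I) - 1)).im = u * Real.sin t := by
      simp [Complex.exp_ofReal_mul_I_im]
    rw [hr, hi]
    have := Real.sin_sq_add_cos_sq t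
    linear_combination u^2 * this
  have hc := Real.cos_le_one_sub_mul_cos_sq ht
  refine abs_le_of_sq_le_sq' ?_ (Real.exp_pos _).le |>.2
  rw [hsq, ← Real.exp_nat_mul]
  have h2 := Real.add_one_le_exp (-(2 * (u - u^2) * (1 - Real.cos t)))
  have h3 : Real.exp (-(2 * (u - u^2) * (1 - Real.cos t))) ≤ Real.exp (((2:ℕ):ℝ) * -(2 / Real.pi^2 * (u - u^2) * t^2)) := by
    apply Real.exp_le_exp.mpr
    push_cast
    nlinarith
  linarith

lemma gk_norm (u t : ℝ) (h0 : 0 ≤ u) (h1 : u ≤ 1) :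
    ‖gk u t‖ ≤ Real.exp (-(2 / Real.pi^2 * (u - u^2) * t^2)) := by
  have hv : 0 ≤ u - u^2 := by nlinarith
  unfold gk
  rw [Complex.norm_real, Real.norm_eq_abs, abs_of_pos (Real.exp_pos _)]
  apply Real.exp_le_exp.mpr
  have hpi : 2 / Real.pi^2 ≤ 1/2 := by
    rw [div_le_iff₀ (by positivity)]
    nlinarith [Real.pi_gt_three]
  have : 0 ≤ (u - u^2) * t^2 := by positivity
  nlinarith

lemma exp_taylor (x : ℂ) (hx : ‖x‖ ≤ 4) (n : ℕ) : ‖Complex.exp x - ∑ m ∈ Finset.range n, x^m / m.factorial‖ ≤ ‖x‖^n * Real.exp 4 := by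
  refine (Complex.norm_exp_sub_sum_le_norm_mul_exp x n).trans ?_
  exact mul_le_mul_of_nonneg_left (Real.exp_le_exp.mpr hx) (by positivity)

set_option maxHeartbeats 1000000 in
lemma fg_diff (u t : ℝ) (h0 : 0 ≤ u) (h1 : u ≤ 1) (ht : |t| ≤ 4) : ‖fk u t - gk u t‖ ≤ 17 * Real.exp 4 * (u * |t|^3) := by
  set E := Real.exp 4
  have hE : 1 ≤ E := Real.one_le_exp (by norm_num)
  set x : ℂ := t * Complex.I with hx
  have hxn : ‖x‖ = |t| := by simp [hx]
  have hx2 : x^2 = -((t:ℂ)^2) := by rw [hx, mul_pow, Complex.I_sq]; ring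
  have ht0 := abs_nonneg t
  set T := |t|
  have hun : ‖(u : ℂ)‖ = u := by rw [Complex.norm_real, Real.norm_eq_abs, abs_of_nonneg h0]
  obtain ⟨R1, hR1⟩ : ∃ R1, R1 = Complex.exp x - (1 + x + x^2/2) := ⟨_, rfl⟩
  have bR1 : ‖R1‖ ≤ T^3 * E := by
    have := exp_taylor x (by rw [hxn]; exact ht) 3
    rw [hxn] at this
    rw [hR1]
    convert this using 3
    simp [Finset.sum_range_succ]
  have huT : u * T ≤ T := by nlinarith
  have hyn : ‖-(u * x)‖ = u * T := by rw [norm_neg, norm_mul, hun, hxn]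
  obtain ⟨R2, hR2⟩ : ∃ R2, R2 = Complex.exp (-(u * x)) - (1 - u * x + u^2 * x^2/2) := ⟨_, rfl⟩
  have bR2 : ‖R2‖ ≤ u * T^3 * E := by
    have := exp_taylor (-(u*x)) (by rw [hyn]; linarith) 3
    rw [hyn] at this
    have h2 : ‖R2‖ ≤ (u * T)^3 * E := by
      rw [hR2]
      convert this using 3
      simp [Finset.sum_range_succ]; ring
    refine h2.trans ?_
    have : u^3 ≤ u := by nlinarith [mul_nonneg h0 h0, mul_nonneg h0 (sub_nonneg.mpr h1)]
    rw [mul_pow]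
    gcongr
  set v := u - u^2
  have hv0 : 0 ≤ v := by simp only [v]; nlinarith
  have hvu : v ≤ u := by simp only [v]; nlinarith
  have hv4 : v ≤ 1/4 := by simp only [v]; nlinarith [sq_nonneg (u - 1/2)]
  have hT2 : t^2 = T^2 := (sq_abs t).symm
  have hs4 : v * t^2/2 ≤ 2 := by
    rw [hT2]; nlinarith
  have hs0 : 0 ≤ v * t^2/2 := by positivity
  obtain ⟨R3, hR3⟩ : ∃ R3 : ℂ, R3 = gk u t - (1 - ((v * t^2/2 : ℝ) : ℂ)) := ⟨_, rfl⟩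
  have hzn : ‖(((-(v * t^2/2) : ℝ)) : ℂ)‖ = v * t^2/2 := by
    rw [Complex.norm_real, Real.norm_eq_abs, abs_neg, abs_of_nonneg hs0]
  have bR3 : ‖R3‖ ≤ u * T^3 * E := by
    have := exp_taylor (((-(v * t^2/2) : ℝ)) : ℂ) (by rw [hzn]; linarith) 2
    rw [hzn] at this
    have h2 : ‖R3‖ ≤ (v * t^2/2)^2 * E := by
      rw [hR3]
      convert this using 3
      · simp [gk, v]
      · simp [Finset.sum_range_succ]; ring
    refine h2.trans ?_
    have : (v * t^2/2)^2 ≤ u * T^3 := by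
      rw [hT2]
      have e1 : (v * T^2/2)^2 = v * (v * T / 4) * T^3 := by ring
      rw [e1]
      have : v * (v * T/4) ≤ u * 1 := by
        apply mul_le_mul hvu _ (by positivity) h0
        nlinarith
      calc _ ≤ u * 1 * T^3 := by gcongr
        _ = _ := by ring
    gcongr
  have hid : fk u t - gk u t = ((x^3 * (u^3 - u^2)/2 + x^4 * u^3/4) + u * R1 * Complex.exp (-(u * x))) + (1 + u * x + u * x^2/2) * R2 - R3 := by
    have e1 : fk u t = (1 + u * (Complex.exp x - 1)) * Complex.exp (-(u * x)) := by
      unfold fk; rw [hx]; ring_nf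
    have e2 : Complex.exp x = 1 + x + x^2/2 + R1 := by rw [hR1]; ring
    have e3 : Complex.exp (-(u * x)) = 1 - u * x + u^2 * x^2/2 + R2 := by rw [hR2]; ring
    have e4 : gk u t = 1 + (u - u^2) * x^2/2 + R3 := by rw [hR3, hx2]; push_cast; simp only [v]; push_cast; ring
    rw [e1, e2, e3, e4]
    ring
  rw [hid]
  have n1 : ‖x^3 * ((u:ℂ)^3 - u^2)/2 + x^4 * u^3/4‖ ≤ 2 * (u * T^3) := by
    refine (norm_add_le _ _).trans ?_
    have a1 : ‖x^3 * ((u:ℂ)^3 - u^2)/2‖ ≤ u * T^3 := by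
      have : ((u:ℂ)^3 - u^2) = ((u^3 - u^2 : ℝ) : ℂ) := by push_cast; ring
      rw [this, norm_div, norm_mul, norm_pow, hxn, Complex.norm_real, Real.norm_eq_abs]
      have : |u^3 - u^2| ≤ u := by
        rw [abs_le]; constructor <;> nlinarith [mul_nonneg h0 h0, mul_nonneg (mul_nonneg h0 h0) (sub_nonneg.mpr h1), mul_nonneg h0 (sub_nonneg.mpr h1)]
      simp only [Complex.norm_ofNat]
      have h3 : 0 ≤ T^3 := by positivity
      nlinarith [mul_le_mul_of_nonneg_left this h3, mul_nonneg h0 h3]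
    have a2 : ‖x^4 * (u:ℂ)^3/4‖ ≤ u * T^3 := by
      rw [norm_div, norm_mul, norm_pow, norm_pow, hxn, hun]
      simp only [Complex.norm_ofNat]
      have h3 : 0 ≤ T^3 := by positivity
      have : u^3 ≤ u := by nlinarith [mul_nonneg h0 h0, mul_nonneg h0 (sub_nonneg.mpr h1)]
      have e : T^4 * u^3/4 = (T/4) * (u^3 * T^3) := by ring
      rw [e]
      calc (T/4) * (u^3 * T^3) ≤ 1 * (u * T^3) := by
            apply mul_le_mul (by linarith) (by gcongr) (by positivity) (by norm_num)
        _ = _ := by ring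
    linarith
  have n2 : ‖u * R1 * Complex.exp (-(u * x))‖ ≤ E * (u * T^3) := by
    have : Complex.exp (-(u * x)) = Complex.exp (((-(u * t) : ℝ) : ℂ) * Complex.I) := by congr 1; rw [hx]; push_cast; ring
    rw [norm_mul, norm_mul, this, Complex.norm_exp_ofReal_mul_I, hun, mul_one]
    nlinarith [mul_le_mul_of_nonneg_left bR1 h0]
  have n3 : ‖(1 + u * x + u * x^2/2) * R2‖ ≤ 13 * (E * (u * T^3)) := by
    rw [norm_mul]
    have : ‖1 + u * x + u * x^2/2‖ ≤ 13 := by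
      refine (norm_add₃_le).trans ?_
      rw [norm_div, norm_mul (u : ℂ) x, norm_mul (u : ℂ) (x^2), norm_pow, hun, hxn]
      simp only [Complex.norm_ofNat, norm_one]
      have : u * T^2 ≤ 16 := by nlinarith
      linarith
    calc _ ≤ 13 * (u * T^3 * E) := mul_le_mul this bR2 (norm_nonneg _) (by norm_num)
      _ = _ := by ring
  refine (norm_sub_le _ _).trans ?_
  have n12 := norm_add_le (x^3 * ((u:ℂ)^3 - u^2)/2 + x^4 * u^3/4) (u * R1 * Complex.exp (-(u * x)))
  have n123 := norm_add_le (x^3 * ((u:ℂ)^3 - u^2)/2 + x^4 * u^3/4 + u * R1 * Complex.exp (-(u * x))) ((1 + u * x + u * x^2/2) * R2)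
  have h3 : 0 ≤ u * T^3 := by positivity
  have h4 : u * T^3 ≤ E * (u * T^3) := le_mul_of_one_le_left h3 hE
  linarith

open Equiv

lemma B_eq (n : ℕ) : B n = ∑ k ∈ Finset.Icc 1 n, ((1/(k:ℝ)) - (1/(k:ℝ))^2) := by
  unfold B
  refine Finset.sum_congr rfl fun k _ => ?_
  rw [one_div_pow]

lemma gk_prod (n : ℕ) (t : ℝ) : ∏ k ∈ Finset.Icc 1 n, gk (1/(k:ℝ)) t = ((Real.exp (-(B n * t^2/2)) : ℝ) : ℂ) := by
  unfold gk
  rw [← Complex.ofReal_prod, ← Real.exp_sum, B_eq]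
  congr 2
  rw [Finset.sum_mul, Finset.sum_div, ← Finset.sum_neg_distrib]

lemma F_diff (n : ℕ) (t : ℝ) (ht : |t| ≤ Real.pi) :
    ‖∏ k ∈ Finset.Icc 1 n, fk (1/(k:ℝ)) t - ((Real.exp (-(B n * t^2/2)) : ℝ) : ℂ)‖ ≤
      68 * Real.exp 4 * |t|^3 * B n * Real.exp (-(2/Real.pi^2 * B n * t^2)) := by
  rw [← gk_prod]
  have hu : ∀ k ∈ Finset.Icc 1 n, 0 ≤ 1/(k:ℝ) ∧ 1/(k:ℝ) ≤ 1 := by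
    intro k hk
    have h1 : (1:ℝ) ≤ k := by exact_mod_cast (Finset.mem_Icc.mp hk).1
    refine ⟨by positivity, ?_⟩
    rw [div_le_one (by linarith)]; exact h1
  have h := (prod_diff (Finset.Icc 1 n) (fun k => fk (1/(k:ℝ)) t) (fun k => gk (1/(k:ℝ)) t)
    (fun k => Real.exp (-(2/Real.pi^2 * ((1/(k:ℝ)) - (1/(k:ℝ))^2) * t^2)))
    (fun k => 68 * Real.exp 4 * |t|^3 * ((1/(k:ℝ)) - (1/(k:ℝ))^2)) ?_ ?_).2
  · refine h.trans (le_of_eq ?_)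
    rw [← Real.exp_sum, ← Finset.mul_sum, ← B_eq]
    congr 2
    rw [B_eq, Finset.mul_sum, Finset.sum_mul, ← Finset.sum_neg_distrib]
  · intro k hk
    exact ⟨fk_norm _ _ (hu k hk).1 (hu k hk).2 ht, gk_norm _ _ (hu k hk).1 (hu k hk).2⟩
  · intro k hk
    obtain ⟨hu0, hu1⟩ := hu k hk
    have hk1 := (Finset.mem_Icc.mp hk).1
    rcases Nat.eq_or_lt_of_le hk1 with h | h
    · subst h
      have : fk (1/((1:ℕ):ℝ)) t - gk (1/((1:ℕ):ℝ)) t = 0 := by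
        simp [fk, gk, ← Complex.exp_add]
      simp only [this]; simp
    · have hu2 : 1/(k:ℝ) ≤ 1/2 := by
        apply one_div_le_one_div_of_le (by norm_num); exact_mod_cast h
      set u := 1/(k:ℝ)
      have h4 : |t| ≤ 4 := ht.trans Real.pi_lt_four.le
      refine (fg_diff u t hu0 hu1 h4).trans ?_
      have huv : u ≤ 2 * (u - u^2) := by nlinarith
      have hv4 : u - u^2 ≤ 1/4 := by nlinarith [sq_nonneg (u - 1/2)]
      have hv0 : 0 ≤ u - u^2 := by linarith
      have he : 1/2 ≤ Real.exp (-(2/Real.pi^2 * (u - u^2) * t^2)) := by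
        have h5 : 2/Real.pi^2 * (u - u^2) * t^2 ≤ 1/2 := by
          have : t^2 ≤ Real.pi^2 := by rw [← sq_abs t]; gcongr
          calc 2/Real.pi^2 * (u - u^2) * t^2 ≤ 2/Real.pi^2 * (1/4) * Real.pi^2 := by gcongr
            _ = 1/2 := by field_simp; norm_num
        have := Real.add_one_le_exp (-(2/Real.pi^2 * (u - u^2) * t^2))
        linarith
      have hT : 0 ≤ Real.exp 4 * |t|^3 := by positivity
      calc 17 * Real.exp 4 * (u * |t|^3) = 17 * (Real.exp 4 * |t|^3) * u := by ring
        _ ≤ 17 * (Real.exp 4 * |t|^3) * (2 * (u - u^2)) := by gcongr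
        _ = 68 * Real.exp 4 * |t|^3 * (u - u^2) * (1/2) := by ring
        _ ≤ _ := by gcongr

lemma phi_F (n ℓ : ℕ) (t : ℝ) : phi n t * Complex.exp (-(ℓ * t * Complex.I)) =
    Complex.exp (Complex.I * ((A n - ℓ : ℝ) : ℂ) * t) * ∏ k ∈ Finset.Icc 1 n, fk (1/(k:ℝ)) t := by
  unfold fk phi
  rw [Finset.prod_mul_distrib, ← Complex.exp_sum]
  have h1 : ∏ k ∈ Finset.Icc 1 n, (1 + ((1/(k:ℝ) : ℝ):ℂ) * (Complex.exp (t * Complex.I) - 1)) = ∏ k ∈ Finset.Icc 1 n, (1 + (Complex.exp (t * Complex.I) - 1) / (k : ℂ)) := by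
    refine Finset.prod_congr rfl fun k _ => ?_
    push_cast; ring
  rw [h1]
  have h2 : ∑ k ∈ Finset.Icc 1 n, -(((1/(k:ℝ) : ℝ):ℂ) * t * Complex.I) = -((A n : ℂ) * t * Complex.I) := by
    unfold A
    rw [Complex.ofReal_sum, Finset.sum_mul, Finset.sum_mul, Finset.sum_neg_distrib]
  rw [h2, mul_left_comm, ← Complex.exp_add]
  congr 2
  push_cast; ring

open Equiv

lemma mom_int (m : ℕ) (b : ℝ) (hb : 0 < b) : MeasureTheory.Integrable (fun t : ℝ => |t|^m * Real.exp (-b * t^2)) := by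
  have := (integrable_rpow_mul_exp_neg_mul_sq (s := (m:ℝ)) hb (by have : (0:ℝ) ≤ m := by positivity
                                                                  linarith)).norm
  refine this.congr (Filter.Eventually.of_forall fun t => ?_)
  simp only [Real.rpow_natCast, norm_mul, norm_pow, Real.norm_eq_abs, Real.abs_exp]

lemma mom_half (m : ℕ) (b : ℝ) (hb : 0 < b) : ∫ t : ℝ, |t|^m * Real.exp (-b * t^2) = b ^ (-((m:ℝ)+1)/2) * Real.Gamma (((m:ℝ)+1)/2) := by
  have h1 := integral_comp_abs (f := fun x : ℝ => x^m * Real.exp (-b * x^2))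
  simp only [sq_abs] at h1
  rw [h1]
  have h2 := integral_rpow_mul_exp_neg_mul_rpow (p := 2) (q := (m:ℝ)) (b := b) (by norm_num) (by have : (0:ℝ) ≤ m := by positivity
                                                                                                 linarith) hb
  simp only [Real.rpow_natCast, Real.rpow_two] at h2
  rw [h2]; ring

lemma mom3 (b : ℝ) (hb : 0 < b) : ∫ t : ℝ, |t|^3 * Real.exp (-b * t^2) = 1/b^2 := by
  rw [mom_half 3 b hb]
  have e1 : (-((3:ℕ):ℝ) - 1) = -4 := by norm_num
  have e2 : (-(((3:ℕ):ℝ)+1)/2) = -((2:ℕ):ℝ) := by norm_num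
  have e3 : ((((3:ℕ):ℝ)+1)/2) = 2 := by norm_num
  rw [e2, e3, Real.Gamma_two, Real.rpow_neg hb.le, Real.rpow_natCast]; simp

lemma mom1 (b : ℝ) (hb : 0 < b) : ∫ t : ℝ, |t|^1 * Real.exp (-b * t^2) = 1/b := by
  rw [mom_half 1 b hb]
  have e2 : (-(((1:ℕ):ℝ)+1)/2) = -((1:ℕ):ℝ) := by norm_num
  have e3 : ((((1:ℕ):ℝ)+1)/2) = 1 := by norm_num
  rw [e2, e3, Real.Gamma_one, Real.rpow_neg hb.le, Real.rpow_natCast]; simp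

lemma gauss_int (b s : ℝ) (hb : 0 < b) : ∫ x : ℝ, Complex.exp (Complex.I * (s:ℂ) * x) * ((Real.exp (-(b * x^2/2)) : ℝ) : ℂ)
    = ((Real.sqrt (2 * Real.pi / b) * Real.exp (-(s^2/(2*b))) : ℝ) : ℂ) := by
  have h := fourierIntegral_gaussian (b := ((b/2 : ℝ) : ℂ)) (by simpa using hb) (s : ℂ)
  have e : ∀ x : ℝ, ((Real.exp (-(b * x^2/2)) : ℝ) : ℂ) = Complex.exp (-((b/2 : ℝ) : ℂ) * (x:ℂ)^2) := by
    intro x; push_cast; congr 1; ring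
  simp only [e]
  rw [h, Real.sqrt_eq_rpow, Complex.ofReal_mul, Complex.ofReal_cpow (by positivity)]
  have e1 : ((Real.pi : ℂ) / ((b/2 : ℝ) : ℂ)) = ((2 * Real.pi / b : ℝ) : ℂ) := by
    push_cast; field_simp
  rw [e1]
  congr 1
  · push_cast; rfl
  · push_cast; congr 1
    ring

lemma plclt (n ℓ : ℕ) (hB : 0 < B n) :
    |2 * Real.pi * pl n ℓ - Real.sqrt (2 * Real.pi / B n) * Real.exp (-((A n - ℓ)^2/(2 * B n)))| ≤
      (68 * Real.exp 4 / (2/Real.pi^2)^2 + 2) / B n := by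
  set s : ℝ := A n - ℓ
  set b := B n
  set c := 2/Real.pi^2 with hc
  have hc0 : 0 < c := by positivity
  have hpi := Real.pi_pos
  have h1 := pl_integral n ℓ
  rw [intervalIntegral.integral_of_le (by linarith), ← MeasureTheory.integral_indicator measurableSet_Ioc] at h1
  have h2 := gauss_int b s hB
  have i1 : MeasureTheory.Integrable (Set.indicator (Set.Ioc (-Real.pi) Real.pi) (fun t : ℝ => phi n t * Complex.exp (-(ℓ * t * Complex.I)))) := by
    rw [MeasureTheory.integrable_indicator_iff measurableSet_Ioc]
    apply Continuous.integrableOn_Ioc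
    unfold phi
    fun_prop
  have nG : ∀ x : ℝ, ‖Complex.exp (Complex.I * (s:ℂ) * x) * ((Real.exp (-(b * x^2/2)) : ℝ) : ℂ)‖ = Real.exp (-(b * x^2/2)) := by
    intro x
    have : Complex.I * (s:ℂ) * x = ((s * x : ℝ) : ℂ) * Complex.I := by push_cast; ring
    rw [norm_mul, this, Complex.norm_exp_ofReal_mul_I, Complex.norm_real, one_mul, Real.norm_eq_abs, Real.abs_exp]
  have i2 : MeasureTheory.Integrable (fun x : ℝ => Complex.exp (Complex.I * (s:ℂ) * x) * ((Real.exp (-(b * x^2/2)) : ℝ) : ℂ)) := by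
    refine (mom_int 0 (b/2) (by positivity)).mono' (by apply Continuous.aestronglyMeasurable; fun_prop) ?_
    refine Filter.Eventually.of_forall fun x => ?_
    rw [nG, pow_zero, one_mul]
    apply le_of_eq; congr 1; ring
  have i3 : MeasureTheory.Integrable (fun t : ℝ => 68 * Real.exp 4 * b * (|t|^3 * Real.exp (-(c*b) * t^2)) + |t|^1 * Real.exp (-(b/2) * t^2)) :=
    ((mom_int 3 (c*b) (by positivity)).const_mul _).add (mom_int 1 (b/2) (by positivity))
  have key := MeasureTheory.norm_integral_le_of_norm_le i3 (f := fun t : ℝ => Set.indicator (Set.Ioc (-Real.pi) Real.pi) (fun t : ℝ => phi n t * Complex.exp (-(ℓ * t * Complex.I))) t - Complex.exp (Complex.I * (s:ℂ) * t) * ((Real.exp (-(b * t^2/2)) : ℝ) : ℂ)) ?_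
  · rw [MeasureTheory.integral_sub i1 i2, h1, h2, MeasureTheory.integral_add ((mom_int 3 (c*b) (by positivity)).const_mul _) (mom_int 1 (b/2) (by positivity)),
      MeasureTheory.integral_const_mul, mom3 _ (by positivity), mom1 _ (by positivity)] at key
    have e1 : (2 * Real.pi * (pl n ℓ : ℂ) - ((Real.sqrt (2 * Real.pi / b) * Real.exp (-(s^2/(2*b))) : ℝ) : ℂ)) = ((2 * Real.pi * pl n ℓ - Real.sqrt (2 * Real.pi / b) * Real.exp (-(s^2/(2 * b))) : ℝ) : ℂ) := by
      push_cast; ring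
    rw [e1, Complex.norm_real, Real.norm_eq_abs] at key
    refine key.trans (le_of_eq ?_)
    field_simp
  · refine Filter.Eventually.of_forall fun t => ?_
    have p1 : 0 ≤ 68 * Real.exp 4 * b * (|t|^3 * Real.exp (-(c*b) * t^2)) := by positivity
    have p2 : 0 ≤ |t|^1 * Real.exp (-(b/2) * t^2) := by positivity
    by_cases ht : t ∈ Set.Ioc (-Real.pi) Real.pi
    · simp only [Set.indicator_of_mem ht]
      rw [phi_F, ← mul_sub, norm_mul]
      have : Complex.I * (s:ℂ) * t = ((s * t : ℝ) : ℂ) * Complex.I := by push_cast; ring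
      rw [this, Complex.norm_exp_ofReal_mul_I, one_mul]
      have := F_diff n t (abs_le.mpr ⟨ht.1.le, ht.2⟩)
      refine this.trans ?_
      have e : 68 * Real.exp 4 * |t|^3 * B n * Real.exp (-(2/Real.pi^2 * B n * t^2)) = 68 * Real.exp 4 * b * (|t|^3 * Real.exp (-(c*b) * t^2)) := by
        have : (-(2/Real.pi^2 * B n * t^2)) = (-(c*b) * t^2) := by ring
        rw [this]; ring
      rw [e]; linarith
    · simp only [Set.indicator_of_notMem ht]
      rw [zero_sub, norm_neg, nG]
      have h1t : 1 ≤ |t| := by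
        by_contra hlt
        push Not at hlt
        have := abs_lt.mp hlt
        have := Real.pi_gt_three
        exact ht ⟨by linarith, by linarith⟩
      have e : -(b * t^2/2) = -(b/2) * t^2 := by ring
      rw [e]
      have : Real.exp (-(b/2) * t^2) ≤ |t|^1 * Real.exp (-(b/2) * t^2) := by
        rw [pow_one]; exact le_mul_of_one_le_left (Real.exp_pos _).le h1t
      linarith

open Equiv

lemma sq_sum_le (n : ℕ) (hn : 1 ≤ n) : ∑ i ∈ Finset.Icc 1 n, 1 / (i:ℝ)^2 ≤ 2 - 1/(n:ℝ) := by
  induction n, hn using Nat.le_induction with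
  | base => simp; norm_num
  | succ m hm ih =>
    rw [Finset.sum_Icc_succ_top (by omega)]
    have hm0 : (0:ℝ) < m := by exact_mod_cast hm
    have : 1/((m+1 : ℕ):ℝ)^2 ≤ 1/(m:ℝ) - 1/((m+1 : ℕ):ℝ) := by
      push_cast
      rw [div_sub_div _ _ hm0.ne' (by positivity), div_le_div_iff₀ (by positivity) (by positivity)]
      nlinarith
    linarith

lemma A_harm (n : ℕ) : A n = ((harmonic n : ℚ) : ℝ) := by
  unfold A
  rw [harmonic_eq_sum_Icc]
  push_cast
  simp

lemma B_lower (n : ℕ) (hn : 1 ≤ n) : Real.log n - 2 ≤ B n := by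
  have h1 : B n = A n - ∑ i ∈ Finset.Icc 1 n, 1 / (i:ℝ)^2 := by
    unfold A B; rw [Finset.sum_sub_distrib]
  have h2 := sq_sum_le n hn
  have h3 := log_add_one_le_harmonic n
  rw [← A_harm] at h3
  have hn0 : (0:ℝ) < n := by exact_mod_cast hn
  have h4 : Real.log n ≤ Real.log ((n+1 : ℕ):ℝ) := Real.log_le_log hn0 (by push_cast; linarith)
  have : 0 < 1/(n:ℝ) := by positivity
  linarith

lemma B_upper (n : ℕ) : B n ≤ n := by
  unfold B
  calc _ ≤ ∑ i ∈ Finset.Icc 1 n, (1:ℝ) := by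
        refine Finset.sum_le_sum fun i hi => ?_
        have h1 : (1:ℝ) ≤ i := by exact_mod_cast (Finset.mem_Icc.mp hi).1
        have : 1/(i:ℝ) ≤ 1 := by rw [div_le_one (by linarith)]; exact h1
        have : 0 ≤ 1/(i:ℝ)^2 := by positivity
        linarith
    _ = n := by simp

theorem local_clt_genus (a : ℝ) (ha : 0 < a) :
    ∃ C > (0 : ℝ), ∃ N : ℕ, ∀ n ≥ N, ∀ ℓ : ℕ,
      Even ((n : ℤ) - (ℓ : ℤ)) →
      ((ℓ : ℝ) - A n) / Real.sqrt (B n) ∈ Set.Icc (-a) a →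
      |Real.sqrt (2 * Real.pi * B n) * Real.exp (((ℓ : ℝ) - A n) ^ 2 / (2 * B n)) *
          cycProb n ℓ - 2| ≤ C / Real.sqrt (Real.log n) := by
  obtain ⟨K, hK, happ⟩ := cycProb_approx
  obtain ⟨D, hD⟩ : ∃ D, D = 68 * Real.exp 4 / (2/Real.pi^2)^2 + 2 := ⟨_, rfl⟩
  have hD0 : 0 < D := by rw [hD]; positivity
  refine ⟨Real.sqrt (4 * Real.pi) * Real.exp (a^2/2) * (K + D), by positivity, max 2 ⌈Real.exp 4⌉₊, ?_⟩
  intro n hn ℓ hev hmem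
  have hn2 : n ≥ 2 := le_trans (le_max_left _ _) hn
  have hne : Real.exp 4 ≤ n := (Nat.le_ceil _).trans (by exact_mod_cast le_trans (le_max_right _ _) hn)
  have hn0 : (0:ℝ) < n := by exact_mod_cast (by omega : 0 < n)
  have hL : 4 ≤ Real.log n := by rwa [Real.le_log_iff_exp_le hn0]
  have hb1 := B_lower n (by omega)
  have hb2 := B_upper n
  have hbL : Real.log n / 2 ≤ B n := by linarith
  have hb0 : 0 < B n := by linarith
  have hr1 := happ n hn2 ℓ hev
  have hr2 := plclt n ℓ hb0
  rw [← hD] at hr2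
  have hsq : (A n - (ℓ:ℝ))^2 = ((ℓ:ℝ) - A n)^2 := by ring
  rw [hsq] at hr2
  have hy : ((ℓ : ℝ) - A n) ^ 2 / (2 * B n) ≤ a^2/2 := by
    have h1 : (((ℓ : ℝ) - A n) / Real.sqrt (B n))^2 ≤ a^2 := sq_le_sq' hmem.1 hmem.2
    rw [div_pow, Real.sq_sqrt hb0.le] at h1
    have : ((ℓ : ℝ) - A n) ^ 2 / (2 * B n) = (((ℓ : ℝ) - A n) ^ 2 / B n)/2 := by field_simp
    rw [this]; linarith
  obtain ⟨y, hy'⟩ : ∃ y, y = ((ℓ : ℝ) - A n) ^ 2 / (2 * B n) := ⟨_, rfl⟩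
  rw [← hy'] at hy hr2 ⊢
  have hpi := Real.pi_pos
  obtain ⟨r1, e1⟩ : ∃ r1, r1 = cycProb n ℓ - 2 * pl n ℓ := ⟨_, rfl⟩
  obtain ⟨r2, e2⟩ : ∃ r2, r2 = 2 * Real.pi * pl n ℓ - Real.sqrt (2 * Real.pi / B n) * Real.exp (-y) := ⟨_, rfl⟩
  rw [← e1] at hr1
  rw [← e2] at hr2
  have hprod : Real.sqrt (2 * Real.pi * B n) * Real.sqrt (2 * Real.pi / B n) = 2 * Real.pi := by
    rw [← Real.sqrt_mul (by positivity)]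
    have : 2 * Real.pi * B n * (2 * Real.pi / B n) = (2 * Real.pi)^2 := by field_simp
    rw [this, Real.sqrt_sq (by positivity)]
  have hee : Real.exp y * Real.exp (-y) = 1 := by rw [← Real.exp_add]; simp
  have hid : Real.sqrt (2 * Real.pi * B n) * Real.exp y * cycProb n ℓ - 2 =
      Real.sqrt (2 * Real.pi * B n) * Real.exp y * (r1 + r2/Real.pi) := by
    have h3 : r1 + r2/Real.pi = cycProb n ℓ - Real.sqrt (2 * Real.pi / B n) * Real.exp (-y)/Real.pi := by
      rw [e1, e2]; field_simp; ring
    rw [h3]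
    have : Real.sqrt (2 * Real.pi * B n) * Real.exp y * (Real.sqrt (2 * Real.pi / B n) * Real.exp (-y)/Real.pi) = 2 := by
      calc _ = (Real.sqrt (2 * Real.pi * B n) * Real.sqrt (2 * Real.pi / B n)) * (Real.exp y * Real.exp (-y)) / Real.pi := by ring
        _ = 2 := by rw [hprod, hee]; field_simp
    rw [mul_sub, this]
  rw [hid, abs_mul, abs_of_nonneg (by positivity)]
  have hr : |r1 + r2/Real.pi| ≤ (K + D)/B n := by
    refine (abs_add_le _ _).trans ?_
    have h1 : K/n ≤ K/B n := by gcongr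
    have h2 : |r2/Real.pi| ≤ |r2| := by
      rw [abs_div, abs_of_pos hpi]
      exact div_le_self (abs_nonneg _) (by linarith [Real.pi_gt_three])
    rw [add_div]; linarith
  have hs : Real.sqrt (2 * Real.pi * B n) / B n ≤ Real.sqrt (4 * Real.pi) / Real.sqrt (Real.log n) := by
    have : Real.sqrt (2 * Real.pi * B n) / B n = Real.sqrt (2 * Real.pi / B n) := by
      rw [div_eq_iff hb0.ne']
      have h5 : B n = Real.sqrt (B n) * Real.sqrt (B n) := (Real.mul_self_sqrt hb0.le).symm
      rw [Real.sqrt_mul (by positivity), Real.sqrt_div (by positivity)]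
      have : Real.sqrt (B n) ≠ 0 := (Real.sqrt_pos.mpr hb0).ne'
      rw [div_mul_eq_mul_div, eq_div_iff this, mul_assoc, ← h5]
    rw [this, ← Real.sqrt_div (by positivity)]
    apply Real.sqrt_le_sqrt
    rw [div_le_div_iff₀ hb0 (by linarith)]
    nlinarith
  calc _ ≤ Real.sqrt (2 * Real.pi * B n) * Real.exp (a^2/2) * ((K + D)/B n) := by gcongr
    _ = (Real.sqrt (2 * Real.pi * B n) / B n) * (Real.exp (a^2/2) * (K + D)) := by ring
    _ ≤ (Real.sqrt (4 * Real.pi) / Real.sqrt (Real.log n)) * (Real.exp (a^2/2) * (K + D)) := by gcongr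
    _ = _ := by ring
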